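/- arXiv:2505.07268 — 4 statements merged into one kernel-verified Lean document; each statement's English description precedes it below -/
import Mathlib

section
/- Let G be a path graph with vertices v_1, …, v_n in path order, and let A, B ⊆ V(G) with m(A) = m(B). Then A and B are reconfigurable under the component sliding rule CS if and only if h_A = h_B, i.e., the left-to-right sequences of component sizes of A and B along the path coincide. -/
open scoped Classical

noncomputable section

/-- `U` induces a connected subgraph of `G`. -/
def IsConnSub {V : Type*} (G : SimpleGraph V) (U : Finset V) : Prop :=
  (G.induce (U : Set V)).Connected

/-- The set of connected components of a vertex subset `U`:
maximal subsets of `U` inducing connected subgraphs. -/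
def comps {V : Type*} [Fintype V] [DecidableEq V] (G : SimpleGraph V) (U : Finset V) :
    Finset (Finset V) :=
  Finset.univ.filter (fun C => C ⊆ U ∧ IsConnSub G C ∧
    ∀ D : Finset V, C ⊆ D → D ⊆ U → IsConnSub G D → D = C)

/-- The CC-multiset of `U`: the multiset of sizes of connected components of `U`. -/
def ccMultiset {V : Type*} [Fintype V] [DecidableEq V] (G : SimpleGraph V) (U : Finset V) :
    Multiset ℕ :=
  (comps G U).val.map Finset.card

/-- Adjacency under component jumping (CJ). -/
def adjCJ {V : Type*} [Fintype V] [DecidableEq V] (G : SimpleGraph V) (U U' : Finset V) : Prop :=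
  ccMultiset G U = ccMultiset G U' ∧
  (comps G U \ comps G U').card = 1 ∧ (comps G U' \ comps G U).card = 1

/-- Adjacency under component sliding (CS). -/
def adjCS {V : Type*} [Fintype V] [DecidableEq V] (G : SimpleGraph V) (U U' : Finset V) : Prop :=
  adjCJ G U U' ∧
  ∀ C ∈ comps G U \ comps G U', ∀ C' ∈ comps G U' \ comps G U, IsConnSub G (C ∪ C')

/-- Adjacency under CS1 (component sliding by one vertex). -/
def adjCS1 {V : Type*} [Fintype V] [DecidableEq V] (G : SimpleGraph V) (U U' : Finset V) : Prop :=
  adjCS G U U' ∧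
  ∀ C ∈ comps G U \ comps G U', ∀ C' ∈ comps G U' \ comps G U,
    (C \ C').card = 1 ∧ (C' \ C).card = 1

/-- Adjacency under token jumping (TJ). -/
def adjTJ {V : Type*} [DecidableEq V] (G : SimpleGraph V) (U U' : Finset V) : Prop :=
  (U \ U').card = 1 ∧ (U' \ U).card = 1

/-- `A` and `B` are reconfigurable under rule `R` keeping the CC-multiset equal to `M`. -/
def Reconf {V : Type*} [Fintype V] [DecidableEq V] (G : SimpleGraph V) (M : Multiset ℕ)
    (R : Finset V → Finset V → Prop) (A B : Finset V) : Prop :=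
  ∃ (ℓ : ℕ) (W : ℕ → Finset V), W 0 = A ∧ W ℓ = B ∧
    (∀ i ≤ ℓ, ccMultiset G (W i) = M) ∧ ∀ i < ℓ, R (W i) (W (i + 1))

end

/-- `h_U`: the sequence of sizes of connected components of `U` along the path,
listed in left-to-right order (ordering components by their minimum vertex). -/
noncomputable def hseq (n : ℕ) (U : Finset (Fin n)) : List ℕ :=
  (((comps (SimpleGraph.pathGraph n) U).image (fun C => C.min)).sort (· ≤ ·)).map
    (fun m => ((comps (SimpleGraph.pathGraph n) U).filter (fun C => C.min = m)).sup Finset.card)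


lemma px_connSub_ordConn {n : ℕ} {C : Finset (Fin n)}
    (h : IsConnSub (SimpleGraph.pathGraph n) C) {x y z : Fin n} (hx : x ∈ C) (hy : y ∈ C)
    (hxz : x ≤ z) (hzy : z ≤ y) : z ∈ C := by
  by_contra hz
  have hr := h.preconnected ⟨x, hx⟩ ⟨y, hy⟩
  rw [SimpleGraph.reachable_iff_reflTransGen] at hr
  have key : ∀ w : ((C : Finset (Fin n)) : Set (Fin n)),
      Relation.ReflTransGen ((SimpleGraph.pathGraph n).induce (C : Set (Fin n))).Adj ⟨x, hx⟩ w →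
      (w : Fin n) < z := by
    intro w hw
    induction hw with
    | refl => exact lt_of_le_of_ne hxz (fun h => hz (h ▸ hx))
    | @tail b c _ hbc ih =>
      have hc : (c : Fin n) ≠ z := fun h => hz (h ▸ c.2)
      simp only [SimpleGraph.comap_adj, SimpleGraph.pathGraph_adj, Function.Embedding.subtype_apply]
        at hbc
      have := Fin.val_ne_of_ne hc
      rw [Fin.lt_def] at ih ⊢
      omega
  exact absurd (key _ hr) (not_lt.mpr hzy)

lemma px_ordConn_connSub {n : ℕ} {C : Finset (Fin n)} (hne : C.Nonempty)
    (h : ∀ x ∈ C, ∀ y ∈ C, ∀ z : Fin n, x ≤ z → z ≤ y → z ∈ C) :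
    IsConnSub (SimpleGraph.pathGraph n) C := by
  have key : ∀ (d : ℕ) (x y : Fin n) (hx : x ∈ C) (hy : y ∈ C), x.val + d = y.val →
      ((SimpleGraph.pathGraph n).induce (C : Set (Fin n))).Reachable ⟨x, hx⟩ ⟨y, hy⟩ := by
    intro d
    induction d with
    | zero =>
      intro x y hx hy he
      have : x = y := Fin.ext (by simpa using he)
      subst this
      exact SimpleGraph.Reachable.refl _
    | succ d ih =>
      intro x y hx hy he
      have hlt : x.val + 1 < n := by have := y.2; omega
      have hz : (⟨x.val + 1, hlt⟩ : Fin n) ∈ C :=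
        h x hx y hy _ (by rw [Fin.le_def]; simp) (by rw [Fin.le_def]; simp; omega)
      refine SimpleGraph.Reachable.trans (SimpleGraph.Adj.reachable ?_)
        (ih ⟨x.val + 1, hlt⟩ y hz hy (by simp; omega))
      simp [SimpleGraph.pathGraph_adj]
  haveI : Nonempty ((C : Finset (Fin n)) : Set (Fin n)) := by
    obtain ⟨x, hx⟩ := hne
    exact ⟨⟨x, hx⟩⟩
  refine ⟨?_⟩
  rintro ⟨x, hx⟩ ⟨y, hy⟩
  rcases le_total x y with hxy | hxy
  · exact key (y.val - x.val) x y hx hy (by rw [Fin.le_def] at hxy; omega)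
  · exact (key (x.val - y.val) y x hy hx (by rw [Fin.le_def] at hxy; omega)).symm

/-- Interval of the path. -/
def pxI (n : ℕ) (a : ℕ × ℕ) : Finset (Fin n) :=
  Finset.univ.filter (fun x => a.1 ≤ x.val ∧ x.val < a.1 + a.2)

/-- Union of the intervals of a list. -/
def pxS (n : ℕ) (L : List (ℕ × ℕ)) : Finset (Fin n) :=
  Finset.univ.filter (fun x => ∃ a ∈ L, a.1 ≤ x.val ∧ x.val < a.1 + a.2)

/-- Valid lists of intervals. -/
def pxValid (n : ℕ) (L : List (ℕ × ℕ)) : Prop :=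
  L.Pairwise (fun a b => a.1 + a.2 < b.1) ∧ ∀ a ∈ L, 0 < a.2 ∧ a.1 + a.2 ≤ n

lemma px_mem_I {n : ℕ} {a : ℕ × ℕ} {x : Fin n} :
    x ∈ pxI n a ↔ a.1 ≤ x.val ∧ x.val < a.1 + a.2 := by simp [pxI]

lemma px_mem_S {n : ℕ} {L : List (ℕ × ℕ)} {x : Fin n} :
    x ∈ pxS n L ↔ ∃ a ∈ L, x ∈ pxI n a := by simp [pxS, pxI]

lemma px_start {n : ℕ} {a : ℕ × ℕ} (h : 0 < a.2 ∧ a.1 + a.2 ≤ n) :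
    (⟨a.1, by omega⟩ : Fin n) ∈ pxI n a := by
  rw [px_mem_I]; simp; omega

lemma px_I_conn {n : ℕ} {a : ℕ × ℕ} (h : 0 < a.2 ∧ a.1 + a.2 ≤ n) :
    IsConnSub (SimpleGraph.pathGraph n) (pxI n a) := by
  refine px_ordConn_connSub ⟨_, px_start h⟩ ?_
  intro x hx y hy z h1 h2
  rw [px_mem_I] at *
  rw [Fin.le_def] at *
  omega

lemma px_I_card {n : ℕ} {a : ℕ × ℕ} (h : a.1 + a.2 ≤ n) : (pxI n a).card = a.2 := by
  have : (pxI n a).map Fin.valEmbedding = Finset.Ico a.1 (a.1 + a.2) := by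
    ext x
    simp only [Finset.mem_map, px_mem_I, Fin.valEmbedding_apply, Finset.mem_Ico]
    constructor
    · rintro ⟨y, hy, rfl⟩; exact hy
    · intro hx; exact ⟨⟨x, by omega⟩, hx, rfl⟩
  rw [← Finset.card_map Fin.valEmbedding, this]; simp

lemma px_I_min {n : ℕ} {a : ℕ × ℕ} (h : 0 < a.2 ∧ a.1 + a.2 ≤ n) :
    (pxI n a).min = ((⟨a.1, by omega⟩ : Fin n) : WithTop (Fin n)) := by
  apply le_antisymm
  · exact Finset.min_le (px_start h)
  · apply Finset.le_min
    intro x hx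
    rw [px_mem_I] at hx
    exact WithTop.coe_le_coe.mpr (by rw [Fin.le_def]; exact hx.1)

lemma px_I_inj {n : ℕ} {a b : ℕ × ℕ} (ha : 0 < a.2 ∧ a.1 + a.2 ≤ n)
    (hb : 0 < b.2 ∧ b.1 + b.2 ≤ n) (h : pxI n a = pxI n b) : a = b := by
  have h1 := px_start ha
  have h2 := px_start hb
  have h3 := px_I_card ha.2
  rw [h, px_mem_I] at h1
  rw [← h, px_mem_I] at h2
  rw [h, px_I_card hb.2] at h3
  simp at h1 h2
  exact Prod.ext (by omega) h3.symm

lemma px_sep {n : ℕ} {L : List (ℕ × ℕ)} (hL : pxValid n L) {a b : ℕ × ℕ} (ha : a ∈ L)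
    (hb : b ∈ L) (hab : a ≠ b) : a.1 + a.2 < b.1 ∨ b.1 + b.2 < a.1 := by
  have := hL.1.imp (S := fun a b : ℕ × ℕ => a.1 + a.2 < b.1 ∨ b.1 + b.2 < a.1) (fun h => Or.inl h)
  haveI : Std.Symm (fun a b : ℕ × ℕ => a.1 + a.2 < b.1 ∨ b.1 + b.2 < a.1) :=
    ⟨fun _ _ h => Or.symm h⟩
  exact List.Pairwise.forall ‹List.Pairwise _ L› ha hb hab

lemma px_conn_sub {n : ℕ} {L : List (ℕ × ℕ)} (hL : pxValid n L) {a : ℕ × ℕ} (ha : a ∈ L)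
    {D : Finset (Fin n)} (hD : D ⊆ pxS n L) (hc : IsConnSub (SimpleGraph.pathGraph n) D)
    {x : Fin n} (hx : x ∈ D) (hxa : x ∈ pxI n a) : D ⊆ pxI n a := by
  intro y hy
  rw [px_mem_I] at *
  have hy2 := y.2
  by_contra hcon
  have hout : ∀ z ∈ D, z.val + 1 = a.1 ∨ z.val = a.1 + a.2 → False := by
    intro z hz hza
    obtain ⟨b, hb, hzb⟩ := px_mem_S.mp (hD hz)
    rw [px_mem_I] at hzb
    by_cases hab : a = b
    · subst hab; omega
    · rcases px_sep hL ha hb hab with h | h <;> omega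
  by_cases h1 : a.1 ≤ y.val
  · exact hout ⟨a.1 + a.2, by omega⟩ (px_connSub_ordConn hc hx hy
      (by rw [Fin.le_def]; simp; omega) (by rw [Fin.le_def]; simp; omega)) (Or.inr rfl)
  · exact hout ⟨a.1 - 1, by omega⟩ (px_connSub_ordConn hc hy hx
      (by rw [Fin.le_def]; simp; omega) (by rw [Fin.le_def]; simp; omega))
      (Or.inl (by simp; omega))

lemma px_mem_comps {n : ℕ} {L : List (ℕ × ℕ)} (hL : pxValid n L) {C : Finset (Fin n)} :
    C ∈ comps (SimpleGraph.pathGraph n) (pxS n L) ↔ ∃ a ∈ L, pxI n a = C := by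
  have hsub : ∀ a ∈ L, pxI n a ⊆ pxS n L := fun a ha x hx => px_mem_S.mpr ⟨a, ha, hx⟩
  simp only [comps, Finset.mem_filter, Finset.mem_univ, true_and]
  constructor
  · rintro ⟨h1, h2, h3⟩
    obtain ⟨⟨x, hx⟩⟩ := h2.nonempty
    obtain ⟨a, ha, hxa⟩ := px_mem_S.mp (h1 hx)
    exact ⟨a, ha, h3 _ (px_conn_sub hL ha h1 h2 hx hxa) (hsub a ha) (px_I_conn (hL.2 a ha))⟩
  · rintro ⟨a, ha, rfl⟩
    refine ⟨hsub a ha, px_I_conn (hL.2 a ha), ?_⟩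
    intro D h1 h2 h3
    have := px_start (hL.2 a ha)
    exact (px_conn_sub hL ha h2 h3 (h1 this) this).antisymm h1

lemma px_mem_comps_I {n : ℕ} {L : List (ℕ × ℕ)} (hL : pxValid n L) {a : ℕ × ℕ}
    (h : 0 < a.2 ∧ a.1 + a.2 ≤ n) :
    pxI n a ∈ comps (SimpleGraph.pathGraph n) (pxS n L) ↔ a ∈ L := by
  rw [px_mem_comps hL]
  constructor
  · rintro ⟨b, hb, he⟩
    rwa [← px_I_inj (hL.2 b hb) h he]
  · intro ha; exact ⟨a, ha, rfl⟩

lemma px_nodup {n : ℕ} {L : List (ℕ × ℕ)} (hL : pxValid n L) : L.Nodup := by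
  refine hL.1.imp ?_
  intro a b h he
  subst he; omega

lemma px_cc {n : ℕ} {L : List (ℕ × ℕ)} (hL : pxValid n L) :
    ccMultiset (SimpleGraph.pathGraph n) (pxS n L) = ((L.map Prod.snd : List ℕ) : Multiset ℕ) := by
  have hnd : (L.map (pxI n)).Nodup :=
    (List.nodup_map_iff_inj_on (px_nodup hL)).mpr
      (fun a ha b hb h => px_I_inj (hL.2 a ha) (hL.2 b hb) h)
  have : (comps (SimpleGraph.pathGraph n) (pxS n L)).val =
      ((L.map (pxI n) : List (Finset (Fin n))) : Multiset (Finset (Fin n))) := by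
    rw [Multiset.Nodup.ext (Finset.nodup _) (Multiset.coe_nodup.mpr hnd)]
    intro C
    rw [Finset.mem_val, px_mem_comps hL]
    simp
  rw [ccMultiset, this, Multiset.map_coe, List.map_map]
  congr 1
  apply List.map_congr_left
  intro a ha
  exact px_I_card (hL.2 a ha).2

lemma px_hseq {n : ℕ} {L : List (ℕ × ℕ)} (hL : pxValid n L) :
    hseq n (pxS n L) = L.map Prod.snd := by
  have hpw : (L.map (fun a => (pxI n a).min)).Pairwise (· < ·) := by
    rw [List.pairwise_map]
    refine hL.1.imp_of_mem ?_
    intro a b ha hb h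
    rw [px_I_min (hL.2 a ha), px_I_min (hL.2 b hb)]
    refine WithTop.coe_lt_coe.mpr ?_
    rw [Fin.lt_def]
    simp; omega
  have himg : (comps (SimpleGraph.pathGraph n) (pxS n L)).image (fun C => C.min) =
      (L.map (fun a => (pxI n a).min)).toFinset := by
    ext m
    simp only [Finset.mem_image, px_mem_comps hL, List.mem_toFinset, List.mem_map]
    constructor
    · rintro ⟨C, ⟨a, ha, rfl⟩, rfl⟩; exact ⟨a, ha, rfl⟩
    · rintro ⟨a, ha, rfl⟩; exact ⟨_, ⟨a, ha, rfl⟩, rfl⟩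
  rw [hseq, himg, (List.toFinset_sort (· ≤ ·) (hpw.imp (fun h => ne_of_lt h))).mpr
    (hpw.imp (fun h => le_of_lt h)), List.map_map]
  apply List.map_congr_left
  intro a ha
  have hf : (comps (SimpleGraph.pathGraph n) (pxS n L)).filter
      (fun C => C.min = (pxI n a).min) = {pxI n a} := by
    ext C
    simp only [Finset.mem_filter, px_mem_comps hL, Finset.mem_singleton]
    constructor
    · rintro ⟨⟨b, hb, rfl⟩, h⟩
      rw [px_I_min (hL.2 a ha), px_I_min (hL.2 b hb)] at h
      have h' := WithTop.coe_injective h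
      simp at h'
      by_cases hab : a = b
      · rw [hab]
      · rcases px_sep hL ha hb hab with h | h <;> omega
    · rintro rfl; exact ⟨⟨a, ha, rfl⟩, rfl⟩
  simp only [Function.comp]
  rw [hf, Finset.sup_singleton, px_I_card (hL.2 a ha).2]

lemma px_exists {n : ℕ} (U : Finset (Fin n)) : ∃ L, pxValid n L ∧ pxS n L = U := by
  have key : ∀ k ≤ n, ∃ L : List (ℕ × ℕ), pxValid n L ∧ (∀ a ∈ L, a.1 + a.2 ≤ k) ∧
      ∀ x : Fin n, (x ∈ pxS n L ↔ x ∈ U ∧ x.val < k) := by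
    intro k
    induction k with
    | zero => intro _; exact ⟨[], by simp [pxValid], by simp, by simp [pxS]⟩
    | succ k ih =>
      intro hk
      obtain ⟨L, hL, hb, hU⟩ := ih (by omega)
      by_cases hkU : (⟨k, by omega⟩ : Fin n) ∈ U
      · have hx : ∀ x : Fin n, (x ∈ U ∧ x.val < k + 1) ↔ (x ∈ U ∧ x.val < k) ∨ x.val = k := by
          intro x
          constructor
          · rintro ⟨h1, h2⟩
            by_cases h : x.val = k
            · exact Or.inr h
            · exact Or.inl ⟨h1, by omega⟩
          · rintro (h | h)
            · exact ⟨h.1, by omega⟩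
            · have : x = ⟨k, by omega⟩ := Fin.ext h
              exact ⟨this ▸ hkU, by omega⟩
        by_cases hlast : ∃ L' a, L = L' ++ [a] ∧ a.1 + a.2 = k
        · obtain ⟨L', a, rfl, ha⟩ := hlast
          refine ⟨L' ++ [(a.1, a.2 + 1)], ?_, ?_, ?_⟩
          · obtain ⟨h1, h2⟩ := hL
            rw [List.pairwise_append] at h1
            refine ⟨?_, ?_⟩
            · rw [List.pairwise_append]
              refine ⟨h1.1, by simp, ?_⟩
              intro c hc d hd
              rw [List.mem_singleton] at hd
              subst hd
              exact h1.2.2 c hc a (by simp)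
            · intro c hc
              rw [List.mem_append, List.mem_singleton] at hc
              rcases hc with hc | rfl
              · exact h2 c (by simp [hc])
              · simp; omega
          · intro c hc
            rw [List.mem_append, List.mem_singleton] at hc
            rcases hc with hc | rfl
            · have := hb c (by simp [hc]); omega
            · simp; omega
          · intro x
            rw [hx, ← hU, px_mem_S, px_mem_S]
            simp only [List.mem_append, List.mem_singleton, or_and_right, exists_or,
              exists_eq_left, px_mem_I]
            have : (a.1 ≤ x.val ∧ x.val < a.1 + (a.2 + 1)) ↔
                (a.1 ≤ x.val ∧ x.val < a.1 + a.2) ∨ x.val = k := by omega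
            rw [this, or_assoc]
        · refine ⟨L ++ [(k, 1)], ?_, ?_, ?_⟩
          · refine ⟨?_, ?_⟩
            · rw [List.pairwise_append]
              refine ⟨hL.1, by simp, ?_⟩
              intro c hc d hd
              rw [List.mem_singleton] at hd
              subst hd
              have h1 := hb c hc
              rcases List.eq_nil_or_concat L with h | ⟨L', a, h⟩
              · subst h; simp at hc
              · simp at h
                have hne : a.1 + a.2 ≠ k := fun he => hlast ⟨L', a, h, he⟩
                have ha := hb a (by simp [h])
                by_cases hac : c = a
                · subst hac; simp; omega
                · have hc' : c ∈ L' := by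
                    rw [h] at hc
                    simpa [hac] using hc
                  have h3 := hL.1
                  rw [h, List.pairwise_append] at h3
                  have := h3.2.2 c hc' a (by simp)
                  simp; omega
            · intro c hc
              rw [List.mem_append, List.mem_singleton] at hc
              rcases hc with hc | rfl
              · exact hL.2 c hc
              · simp; omega
          · intro c hc
            rw [List.mem_append, List.mem_singleton] at hc
            rcases hc with hc | rfl
            · have := hb c hc; omega
            · simp
          · intro x
            rw [hx, ← hU, px_mem_S, px_mem_S]
            simp only [List.mem_append, List.mem_singleton, or_and_right, exists_or,
              exists_eq_left, px_mem_I]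
            have : (k ≤ x.val ∧ x.val < k + 1) ↔ x.val = k := by omega
            rw [this]
      · refine ⟨L, hL, fun a ha => (hb a ha).trans (by omega), ?_⟩
        intro x
        rw [hU]
        refine and_congr_right (fun hxU => ?_)
        have : x.val ≠ k := by
          rintro rfl
          exact hkU hxU
        omega
  obtain ⟨L, hL, _, hU⟩ := key n le_rfl
  exact ⟨L, hL, by ext x; rw [hU]; simp⟩

lemma px_adj_hseq {n : ℕ} {U U' : Finset (Fin n)}
    (h : adjCS (SimpleGraph.pathGraph n) U U') : hseq n U = hseq n U' := by
  obtain ⟨L, hL, rfl⟩ := px_exists U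
  obtain ⟨L', hL', rfl⟩ := px_exists U'
  obtain ⟨⟨hm, h1, h2⟩, h3⟩ := h
  rw [Finset.card_eq_one] at h1 h2
  obtain ⟨C, hC⟩ := h1
  obtain ⟨C', hC'⟩ := h2
  have hCm : C ∈ comps (SimpleGraph.pathGraph n) (pxS n L) \
    comps (SimpleGraph.pathGraph n) (pxS n L') := by rw [hC]; simp
  have hCm' : C' ∈ comps (SimpleGraph.pathGraph n) (pxS n L') \
    comps (SimpleGraph.pathGraph n) (pxS n L) := by rw [hC']; simp
  have hconn := h3 C hCm C' hCm'
  have hCm2 := hCm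
  have hCm2' := hCm'
  rw [Finset.mem_sdiff, px_mem_comps hL] at hCm
  rw [Finset.mem_sdiff, px_mem_comps hL'] at hCm'
  obtain ⟨⟨a, ha, rfl⟩, haL'⟩ := hCm
  obtain ⟨⟨a', ha', rfl⟩, haL⟩ := hCm'
  rw [px_mem_comps_I hL' (hL.2 a ha)] at haL'
  rw [px_mem_comps_I hL (hL'.2 a' ha')] at haL
  have hmem : ∀ b ∈ L, b ≠ a → b ∈ L' := by
    intro b hb hba
    by_contra hbL'
    have : pxI n b ∈ comps (SimpleGraph.pathGraph n) (pxS n L) \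
        comps (SimpleGraph.pathGraph n) (pxS n L') := by
      rw [Finset.mem_sdiff, px_mem_comps_I hL (hL.2 b hb), px_mem_comps_I hL' (hL.2 b hb)]
      exact ⟨hb, hbL'⟩
    rw [hC, Finset.mem_singleton] at this
    exact hba (px_I_inj (hL.2 b hb) (hL.2 a ha) this)
  have hmem' : ∀ b ∈ L', b ≠ a' → b ∈ L := by
    intro b hb hba
    by_contra hbL'
    have : pxI n b ∈ comps (SimpleGraph.pathGraph n) (pxS n L') \
        comps (SimpleGraph.pathGraph n) (pxS n L) := by
      rw [Finset.mem_sdiff, px_mem_comps_I hL (hL'.2 b hb), px_mem_comps_I hL' (hL'.2 b hb)]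
      exact ⟨hb, hbL'⟩
    rw [hC', Finset.mem_singleton] at this
    exact hba (px_I_inj (hL'.2 b hb) (hL'.2 a' ha') this)
  have hmid : ∀ b ∈ L, b ≠ a → ¬ (a.1 + a.2 < b.1 ∧ b.1 + b.2 < a'.1) ∧
      ¬ (a'.1 + a'.2 < b.1 ∧ b.1 + b.2 < a.1) := by
    intro b hb hba
    have hbv := hL.2 b hb
    have hs := px_start (hL.2 a ha)
    have hs' := px_start (hL'.2 a' ha')
    constructor
    · rintro ⟨h4, h5⟩
      have := px_connSub_ordConn hconn (z := ⟨b.1, by omega⟩) (Finset.mem_union_left _ hs)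
        (Finset.mem_union_right _ hs') (by rw [Fin.le_def]; simp; omega)
        (by rw [Fin.le_def]; simp; omega)
      rw [Finset.mem_union, px_mem_I, px_mem_I] at this
      simp at this
      omega
    · rintro ⟨h4, h5⟩
      have := px_connSub_ordConn hconn (z := ⟨b.1, by omega⟩) (Finset.mem_union_right _ hs')
        (Finset.mem_union_left _ hs) (by rw [Fin.le_def]; simp; omega)
        (by rw [Fin.le_def]; simp; omega)
      rw [Finset.mem_union, px_mem_I, px_mem_I] at this
      simp at this
      omega
  -- the replaced list
  set f : ℕ × ℕ → ℕ × ℕ := fun b => if b = a then a' else b with hf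
  have hpw : (L.map f).Pairwise (fun a b => a.1 + a.2 < b.1) := by
    rw [List.pairwise_map]
    refine hL.1.imp_of_mem ?_
    intro b c hb hc hbc
    have hbv := hL.2 b hb
    have hcv := hL.2 c hc
    by_cases hba : b = a
    · by_cases hca : c = a
      · subst hba; subst hca; omega
      · have hca' : c ≠ a' := fun h => haL (h ▸ hc)
        have h5 := px_sep hL' (hmem c hc hca) ha' hca'
        have h6 := hmid c hc hca
        simp only [hf, hba, hca, if_true, if_false]
        subst hba
        omega
    · by_cases hca : c = a
      · have hba' : b ≠ a' := fun h => haL (h ▸ hb)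
        have h5 := px_sep hL' (hmem b hb hba) ha' hba'
        have h6 := hmid b hb hba
        simp only [hf, hba, hca, if_true, if_false]
        subst hca
        omega
      · simp only [hf, hba, hca, if_false]
        exact hbc
  have hmemf : ∀ b, b ∈ L.map f ↔ b ∈ L' := by
    intro b
    rw [List.mem_map]
    constructor
    · rintro ⟨c, hc, rfl⟩
      by_cases hca : c = a
      · simpa [hf, hca] using ha'
      · simpa [hf, hca] using hmem c hc hca
    · intro hb
      by_cases hba : b = a'
      · exact ⟨a, ha, by simp [hf, hba]⟩
      · have hbL := hmem' b hb hba
        have : b ≠ a := fun h => haL' (h ▸ hb)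
        exact ⟨b, hbL, by simp [hf, this]⟩
  have hval : pxValid n (L.map f) := ⟨hpw, fun b hb => hL'.2 b ((hmemf b).mp hb)⟩
  have hperm : (L.map f).Perm L' :=
    (List.perm_ext_iff_of_nodup (px_nodup hval) (px_nodup hL')).mpr hmemf
  have heq : L.map f = L' := by
    refine hperm.eq_of_pairwise ?_ hpw hL'.1
    intro b c hb hc h4 h5
    omega
  have hsz : a.2 = a'.2 := by
    rw [px_cc hL, px_cc hL'] at hm
    have e1 : (L.map Prod.snd).Perm (L'.map Prod.snd) := Multiset.coe_eq_coe.mp hm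
    obtain ⟨s, t, rfl⟩ := List.append_of_mem ha
    have hnd := px_nodup hL
    have hs : ∀ b ∈ s, f b = b := by
      intro b hb
      have : b ≠ a := by
        rintro rfl
        rw [List.nodup_append] at hnd
        exact hnd.2.2 b hb b (by simp) rfl
      simp [hf, this]
    have ht : ∀ b ∈ t, f b = b := by
      intro b hb
      have : b ≠ a := by
        rintro rfl
        rw [List.nodup_append, List.nodup_cons] at hnd
        exact hnd.2.1.1 hb
      simp [hf, this]
    have e2 := e1.sum_eq
    have e3 : (s ++ a :: t).map f = s ++ a' :: t := by
      rw [List.map_append, List.map_cons, List.map_congr_left hs, List.map_congr_left ht]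
      simp [hf]
    rw [← heq, e3] at e2
    simp at e2
    exact e2
  rw [px_hseq hL, px_hseq hL', ← heq, List.map_map]
  apply List.map_congr_left
  intro b _
  by_cases hba : b = a
  · simp [hf, hba, hsz]
  · simp [hf, hba]

lemma px_step {n : ℕ} {P R : List (ℕ × ℕ)} {a b : ℕ × ℕ} (hL : pxValid n (P ++ a :: R))
    (hL2 : pxValid n (P ++ b :: R)) (hab : b.1 + 1 = a.1) (hs : a.2 = b.2) :
    adjCS (SimpleGraph.pathGraph n) (pxS n (P ++ a :: R)) (pxS n (P ++ b :: R)) := by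
  have hne : a ≠ b := by rintro rfl; omega
  have hav := hL.2 a (by simp)
  have hbv := hL2.2 b (by simp)
  have hn1 := px_nodup hL
  have hn2 := px_nodup hL2
  have haP : a ∉ P ++ b :: R := by
    rw [List.nodup_middle, List.nodup_cons] at hn1
    simp only [List.mem_append, List.mem_cons, not_or] at hn1 ⊢
    exact ⟨hn1.1.1, hne, hn1.1.2⟩
  have hbP : b ∉ P ++ a :: R := by
    rw [List.nodup_middle, List.nodup_cons] at hn2
    simp only [List.mem_append, List.mem_cons, not_or] at hn2 ⊢
    exact ⟨hn2.1.1, hne.symm, hn2.1.2⟩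
  have d1 : comps (SimpleGraph.pathGraph n) (pxS n (P ++ a :: R)) \
      comps (SimpleGraph.pathGraph n) (pxS n (P ++ b :: R)) = {pxI n a} := by
    ext C
    rw [Finset.mem_sdiff, Finset.mem_singleton]
    constructor
    · rintro ⟨h1, h2⟩
      obtain ⟨c, hc, rfl⟩ := (px_mem_comps hL).mp h1
      rw [px_mem_comps_I hL2 (hL.2 c hc)] at h2
      simp only [List.mem_append, List.mem_cons, not_or] at hc h2
      have : c = a := by tauto
      rw [this]
    · rintro rfl
      rw [px_mem_comps_I hL hav, px_mem_comps_I hL2 hav]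
      exact ⟨by simp, haP⟩
  have d2 : comps (SimpleGraph.pathGraph n) (pxS n (P ++ b :: R)) \
      comps (SimpleGraph.pathGraph n) (pxS n (P ++ a :: R)) = {pxI n b} := by
    ext C
    rw [Finset.mem_sdiff, Finset.mem_singleton]
    constructor
    · rintro ⟨h1, h2⟩
      obtain ⟨c, hc, rfl⟩ := (px_mem_comps hL2).mp h1
      rw [px_mem_comps_I hL (hL2.2 c hc)] at h2
      simp only [List.mem_append, List.mem_cons, not_or] at hc h2
      have : c = b := by tauto
      rw [this]
    · rintro rfl
      rw [px_mem_comps_I hL hbv, px_mem_comps_I hL2 hbv]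
      exact ⟨by simp, hbP⟩
  refine ⟨⟨?_, ?_, ?_⟩, ?_⟩
  · rw [px_cc hL, px_cc hL2]; simp [hs]
  · rw [d1]; simp
  · rw [d2]; simp
  · intro C hC C' hC'
    rw [d1, Finset.mem_singleton] at hC
    rw [d2, Finset.mem_singleton] at hC'
    subst hC; subst hC'
    refine px_ordConn_connSub ⟨_, Finset.mem_union_left _ (px_start hav)⟩ ?_
    intro x hx y hy z h1 h2
    rw [Finset.mem_union, px_mem_I, px_mem_I] at *
    rw [Fin.le_def] at *
    omega

lemma px_adj_symm {n : ℕ} {U U' : Finset (Fin n)}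
    (h : adjCS (SimpleGraph.pathGraph n) U U') : adjCS (SimpleGraph.pathGraph n) U' U := by
  obtain ⟨⟨h1, h2, h3⟩, h4⟩ := h
  refine ⟨⟨h1.symm, h3, h2⟩, ?_⟩
  intro C hC C' hC'
  rw [Finset.union_comm]
  exact h4 C' hC' C hC

lemma px_diff : ∀ (L L' : List (ℕ × ℕ)), L.map Prod.snd = L'.map Prod.snd → L ≠ L' →
    ∃ P a b R R', L = P ++ a :: R ∧ L' = P ++ b :: R' ∧ a.1 ≠ b.1 ∧ a.2 = b.2
  | [], [], _, hne => absurd rfl hne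
  | [], _ :: _, h, _ => by simp at h
  | _ :: _, [], h, _ => by simp at h
  | a :: L, b :: L', h, hne => by
    simp only [List.map_cons, List.cons.injEq] at h
    by_cases hab : a.1 = b.1
    · have hab' : a = b := Prod.ext hab h.1
      subst hab'
      obtain ⟨P, c, d, R, R', h1, h2, h3⟩ := px_diff L L' h.2 (fun e => hne (by rw [e]))
      exact ⟨a :: P, c, d, R, R', by simp [h1], by simp [h2], h3⟩
    · exact ⟨[], a, b, L, L', rfl, rfl, hab, h.1⟩

lemma px_shift {n : ℕ} {P R R' : List (ℕ × ℕ)} {a b : ℕ × ℕ} (hL : pxValid n (P ++ a :: R))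
    (hL2 : pxValid n (P ++ b :: R')) (hab : b.1 < a.1) :
    pxValid n (P ++ (a.1 - 1, a.2) :: R) := by
  obtain ⟨h1, h2⟩ := hL
  obtain ⟨h3, h4⟩ := hL2
  rw [List.pairwise_append, List.pairwise_cons] at h1 h3
  refine ⟨?_, ?_⟩
  · rw [List.pairwise_append, List.pairwise_cons]
    refine ⟨h1.1, ⟨?_, h1.2.1.2⟩, ?_⟩
    · intro c hc
      have := h1.2.1.1 c hc
      simp; omega
    · intro c hc d hd
      rw [List.mem_cons] at hd
      rcases hd with rfl | hd
      · have := h3.2.2 c hc b (by simp)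
        simp; omega
      · exact h1.2.2 c hc d (by simp [hd])
  · intro c hc
    simp only [List.mem_append, List.mem_cons] at hc
    rcases hc with hc | rfl | hc
    · exact h2 c (by simp [hc])
    · have := h2 a (by simp)
      simp; omega
    · exact h2 c (by simp [hc])

lemma px_reach {n : ℕ} : ∀ (N : ℕ) (L L' : List (ℕ × ℕ)), pxValid n L → pxValid n L' →
    L.map Prod.snd = L'.map Prod.snd → (L.map Prod.fst).sum + (L'.map Prod.fst).sum = N →
    Relation.ReflTransGen (adjCS (SimpleGraph.pathGraph n)) (pxS n L) (pxS n L') := by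
  intro N
  induction N using Nat.strong_induction_on with
  | _ N ih =>
    intro L L' hL hL' hs hN
    by_cases hne : L = L'
    · rw [hne]
    obtain ⟨P, a, b, R, R', rfl, rfl, h1, h2⟩ := px_diff L L' hs hne
    rcases lt_or_gt_of_ne h1 with h | h
    · have hv := px_shift hL' hL h
      have hst := px_step hL' hv (by simp; omega) rfl
      refine Relation.ReflTransGen.tail (ih _ ?_ _ _ hL hv (by simpa using hs) rfl)
        (px_adj_symm hst)
      simp at hN ⊢
      omega
    · have hv := px_shift hL hL' h
      have hst := px_step hL hv (by simp; omega) rfl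
      refine Relation.ReflTransGen.head hst (ih _ ?_ _ _ hv hL' (by simpa using hs) rfl)
      simp at hN ⊢
      omega

lemma px_reconf {n : ℕ} {A B : Finset (Fin n)}
    (h : Relation.ReflTransGen (adjCS (SimpleGraph.pathGraph n)) A B) :
    Reconf (SimpleGraph.pathGraph n) (ccMultiset (SimpleGraph.pathGraph n) A)
      (adjCS (SimpleGraph.pathGraph n)) A B := by
  induction h with
  | refl => exact ⟨0, fun _ => A, rfl, rfl, fun _ _ => rfl, fun i hi => absurd hi (by omega)⟩
  | @tail B C _ hBC ih =>
    obtain ⟨l, W, h0, hl, hm, hr⟩ := ih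
    refine ⟨l + 1, fun i => if i ≤ l then W i else C, by simp [h0], by simp, ?_, ?_⟩
    · intro i hi
      by_cases hil : i ≤ l
      · simpa [hil] using hm i hil
      · simp only [hil, if_false]
        rw [← hBC.1.1, ← hl]
        exact hm l le_rfl
    · intro i hi
      by_cases hil : i < l
      · have e1 : i ≤ l := by omega
        have e2 : i + 1 ≤ l := by omega
        simpa [e1, e2] using hr i hil
      · have : i = l := by omega
        subst this
        simpa [hl] using hBC

/-- On a path graph, `A` and `B` with `m(A) = m(B)` are reconfigurable
under CS iff their left-to-right component-size sequences coincide. -/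
theorem stmt3 (n : ℕ) (A B : Finset (Fin n))
    (hm : ccMultiset (SimpleGraph.pathGraph n) A = ccMultiset (SimpleGraph.pathGraph n) B) :
    Reconf (SimpleGraph.pathGraph n) (ccMultiset (SimpleGraph.pathGraph n) A)
      (adjCS (SimpleGraph.pathGraph n)) A B ↔ hseq n A = hseq n B := by
  constructor
  · rintro ⟨l, W, rfl, rfl, _, hr⟩
    have key : ∀ i ≤ l, hseq n (W 0) = hseq n (W i) := by
      intro i
      induction i with
      | zero => intro _; rfl
      | succ i ih => intro hi; exact (ih (by omega)).trans (px_adj_hseq (hr i (by omega)))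
    exact key l le_rfl
  · intro h
    obtain ⟨L, hL, rfl⟩ := px_exists A
    obtain ⟨L', hL', rfl⟩ := px_exists B
    rw [px_hseq hL, px_hseq hL'] at h
    exact px_reconf (px_reach _ L L' hL hL' h rfl)
end

section
/- Let G be a path graph with n vertices and let A, B ⊆ V(G) with m(A) = m(B), each having k connected components. Then A and B are reconfigurable under the component jumping rule CJ if and only if max over all inversions (x_i, y_j) ∈ inv(h'_A, h'_B) of min{x, y} is at most the buffer b(A, k) = n − |A| − k (where the maximum over an empty set of inversions is taken to be 0, so in particular if h_A = h_B the answer is YES). -/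
open scoped Classical

/-- The position in `hB` of the subscripted element corresponding to position `p` of `hA`:
the unique index `q` such that `hB` has the same value at `q` as `hA` at `p`, with the same
occurrence count among equal values in the prefix up to and including itself. -/
def matchIdx (hA hB : List ℕ) (p : ℕ) : ℕ :=
  ((List.range hB.length).find? (fun q =>
    decide (hB.getD q 0 = hA.getD p 0 ∧
      (hB.take (q + 1)).count (hA.getD p 0) = (hA.take (p + 1)).count (hA.getD p 0)))).getD 0

/-- `(p, q)` is an inversion between `hA` and `hB`: positions `p < q` in `hA` whose
corresponding subscripted elements appear in the reversed order in `hB`. -/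
def IsInv (hA hB : List ℕ) (p q : ℕ) : Prop :=
  p < q ∧ q < hA.length ∧ matchIdx hA hB q < matchIdx hA hB p

def PValid : ℕ → List (ℕ × ℕ) → ℕ → Prop
  | a, [], m => a ≤ m
  | a, c :: L, m => a ≤ c.1 ∧ 1 ≤ c.2 ∧ PValid (c.1 + c.2 + 1) L m

def ivl (n : ℕ) (c : ℕ × ℕ) : Finset (Fin n) :=
  Finset.univ.filter (fun v => c.1 ≤ v.1 ∧ v.1 < c.1 + c.2)

def toSt (n : ℕ) (L : List (ℕ × ℕ)) : Finset (Fin n) :=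
  Finset.univ.filter (fun v => ∃ c ∈ L, c.1 ≤ v.1 ∧ v.1 < c.1 + c.2)

def wsum (L : List (ℕ × ℕ)) : ℕ := (L.map (fun c => c.2 + 1)).sum

theorem mem_ivl {n : ℕ} {c : ℕ × ℕ} {v : Fin n} :
    v ∈ ivl n c ↔ c.1 ≤ v.1 ∧ v.1 < c.1 + c.2 := by simp [ivl]

theorem mem_toSt {n : ℕ} {L : List (ℕ × ℕ)} {v : Fin n} :
    v ∈ toSt n L ↔ ∃ c ∈ L, c.1 ≤ v.1 ∧ v.1 < c.1 + c.2 := by simp [toSt]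

theorem PValid.mono_left {a a' m : ℕ} {L : List (ℕ × ℕ)} (h : PValid a L m) (ha : a' ≤ a) :
    PValid a' L m := by
  cases L with
  | nil => simp only [PValid] at *; omega
  | cons c L => simp only [PValid] at *; exact ⟨by omega, h.2⟩

theorem PValid.mono_right {a m m' : ℕ} {L : List (ℕ × ℕ)} (h : PValid a L m) (ha : m ≤ m') :
    PValid a L m' := by
  induction L generalizing a with
  | nil => simp only [PValid] at *; omega
  | cons c L ih => simp only [PValid] at *; exact ⟨h.1, h.2.1, ih h.2.2⟩

theorem PValid.bound {a m : ℕ} {L : List (ℕ × ℕ)} (h : PValid a L m) : a + wsum L ≤ m := by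
  induction L generalizing a with
  | nil => simp only [PValid, wsum] at *; simpa using h
  | cons c L ih =>
    simp only [PValid, wsum, List.map_cons, List.sum_cons] at *
    have := ih h.2.2
    omega

theorem pvalid_append {a m : ℕ} {L M : List (ℕ × ℕ)} :
    PValid a (L ++ M) m ↔ ∃ e, PValid a L e ∧ PValid e M m := by
  induction L generalizing a with
  | nil =>
    simp only [PValid, List.nil_append]
    exact ⟨fun h => ⟨a, le_rfl, h⟩, fun ⟨e, h1, h2⟩ => h2.mono_left h1⟩
  | cons c L ih =>
    simp only [PValid, List.cons_append, ih]
    constructor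
    · rintro ⟨h1, h2, e, h3, h4⟩
      exact ⟨e, ⟨h1, h2, h3⟩, h4⟩
    · rintro ⟨e, ⟨h1, h2, h3⟩, h4⟩
      exact ⟨h1, h2, e, h3, h4⟩

theorem wsum_append (L M : List (ℕ × ℕ)) : wsum (L ++ M) = wsum L + wsum M := by
  simp [wsum]

theorem wsum_cons (c : ℕ × ℕ) (M : List (ℕ × ℕ)) : wsum (c :: M) = c.2 + 1 + wsum M := by
  simp [wsum]

theorem PValid.mem {a m : ℕ} {L : List (ℕ × ℕ)} (h : PValid a L m) {c : ℕ × ℕ} (hc : c ∈ L) :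
    a ≤ c.1 ∧ 1 ≤ c.2 ∧ c.1 + c.2 + 1 ≤ m := by
  induction L generalizing a with
  | nil => simp at hc
  | cons d L ih =>
    simp only [PValid] at h
    rcases List.mem_cons.1 hc with rfl | hc
    · have := h.2.2.bound
      refine ⟨h.1, h.2.1, by omega⟩
    · have := ih h.2.2 hc
      refine ⟨by omega, this.2⟩

theorem PValid.pairwise {a m : ℕ} {L : List (ℕ × ℕ)} (h : PValid a L m) :
    L.Pairwise (fun c d => c.1 + c.2 < d.1) := by
  induction L generalizing a with
  | nil => simp
  | cons d L ih =>
    simp only [PValid] at h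
    refine List.pairwise_cons.2 ⟨fun c hc => ?_, ih h.2.2⟩
    have := h.2.2.mem hc
    omega

theorem PValid.nodup {a m : ℕ} {L : List (ℕ × ℕ)} (h : PValid a L m) : L.Nodup := by
  refine h.pairwise.imp ?_
  rintro c d h rfl
  omega

theorem PValid.sep {a m : ℕ} {L : List (ℕ × ℕ)} (h : PValid a L m) {c d : ℕ × ℕ}
    (hc : c ∈ L) (hd : d ∈ L) : c = d ∨ c.1 + c.2 < d.1 ∨ d.1 + d.2 < c.1 := by
  induction L generalizing a with
  | nil => simp at hc
  | cons e L ih =>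
    simp only [PValid] at h
    rcases List.mem_cons.1 hc with rfl | hc'
    · rcases List.mem_cons.1 hd with rfl | hd
      · exact Or.inl rfl
      · have := h.2.2.mem hd
        omega
    · rcases List.mem_cons.1 hd with rfl | hd
      · have := h.2.2.mem hc'
        omega
      · exact ih h.2.2 hc' hd

/-! connectivity -/

theorem conn_interval {n : ℕ} {C : Finset (Fin n)} (hne : C.Nonempty)
    (hoc : ∀ u ∈ C, ∀ v ∈ C, ∀ w, u ≤ w → w ≤ v → w ∈ C) :
    IsConnSub (SimpleGraph.pathGraph n) C := by
  unfold IsConnSub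
  have key : ∀ d : ℕ, ∀ u v : (C : Set (Fin n)), u.1.1 + d = v.1.1 →
      ((SimpleGraph.pathGraph n).induce (C : Set (Fin n))).Reachable u v := by
    intro d
    induction d with
    | zero =>
      intro u v h
      have : u = v := Subtype.ext (Fin.ext (by simpa using h))
      subst this
      exact SimpleGraph.Reachable.refl _
    | succ d ih =>
      intro u v h
      have hlt : u.1.1 + 1 < n := by have := v.1.2; omega
      have hmem : (⟨u.1.1 + 1, hlt⟩ : Fin n) ∈ C :=
        hoc u.1 u.2 v.1 v.2 _ (by rw [Fin.le_def]; simp) (by show u.1.1 + 1 ≤ v.1.1; omega)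
      refine SimpleGraph.Reachable.trans (v := ⟨⟨u.1.1 + 1, hlt⟩, hmem⟩) ?_ (ih _ _ (by show u.1.1 + 1 + d = v.1.1; omega))
      apply SimpleGraph.Adj.reachable
      simp [SimpleGraph.pathGraph_adj]
  obtain ⟨x, hx⟩ := hne
  have : Nonempty (C : Set (Fin n)) := ⟨⟨x, hx⟩⟩
  refine SimpleGraph.Connected.mk ?_
  intro u v
  rcases le_total u.1.1 v.1.1 with h | h
  · exact key (v.1.1 - u.1.1) u v (by omega)
  · exact (key (u.1.1 - v.1.1) v u (by omega)).symm

theorem interval_conn {n : ℕ} {C : Finset (Fin n)} (h : IsConnSub (SimpleGraph.pathGraph n) C) :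
    C.Nonempty ∧ ∀ u ∈ C, ∀ v ∈ C, ∀ w, u ≤ w → w ≤ v → w ∈ C := by
  unfold IsConnSub at h
  refine ⟨?_, ?_⟩
  · obtain ⟨x⟩ := h.nonempty
    exact ⟨x.1, x.2⟩
  · intro u hu v hv w huw hwv
    by_contra hw
    have hr := h.preconnected ⟨u, hu⟩ ⟨v, hv⟩
    rw [SimpleGraph.reachable_iff_reflTransGen] at hr
    have key : ∀ x : (C : Set (Fin n)), Relation.ReflTransGen
        ((SimpleGraph.pathGraph n).induce (C : Set (Fin n))).Adj ⟨u, hu⟩ x → x.1.1 < w.1 := by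
      intro x hx
      induction hx with
      | refl =>
        have : u ≠ w := fun e => hw (e ▸ hu)
        exact Fin.lt_def.1 (lt_of_le_of_ne huw this)
      | @tail b c _ hbc ih =>
        have hc : c.1 ≠ w := fun e => hw (e ▸ c.2)
        have hc' : c.1.1 ≠ w.1 := fun e => hc (Fin.ext e)
        simp [SimpleGraph.pathGraph_adj] at hbc
        omega
    have := key _ hr
    simp only at this
    have := Fin.le_def.1 hwv
    omega

theorem conn_ivl {n : ℕ} {c : ℕ × ℕ} (h1 : 1 ≤ c.2) (h2 : c.1 + c.2 ≤ n) :
    IsConnSub (SimpleGraph.pathGraph n) (ivl n c) := by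
  apply conn_interval
  · exact ⟨⟨c.1, by omega⟩, mem_ivl.2 ⟨by simp, by simp; omega⟩⟩
  · intro u hu v hv w huw hwv
    rw [mem_ivl] at *
    rw [Fin.le_def] at *
    omega

theorem ivl_absorb {n : ℕ} {L : List (ℕ × ℕ)} (h : PValid 0 L (n + 1)) {c : ℕ × ℕ} (hc : c ∈ L)
    {D : Finset (Fin n)} (hD : IsConnSub (SimpleGraph.pathGraph n) D) (hDL : D ⊆ toSt n L)
    {v : Fin n} (hv : v ∈ D) (hvc : v ∈ ivl n c) : D ⊆ ivl n c := by
  have hoc := (interval_conn hD).2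
  have hm := h.mem hc
  rw [mem_ivl] at hvc
  intro w hw
  rw [mem_ivl]
  by_contra hcon
  have hcases : w.1 < c.1 ∨ c.1 + c.2 ≤ w.1 := by omega
  rcases hcases with hlt | hge
  · have hx : (⟨c.1 - 1, by omega⟩ : Fin n) ∈ D :=
      hoc w hw v hv _ (by rw [Fin.le_def]; simp; omega) (by rw [Fin.le_def]; simp; omega)
    obtain ⟨d, hd, h1, h2⟩ := mem_toSt.1 (hDL hx)
    simp only at h1 h2
    rcases h.sep hc hd with rfl | h3 | h3 <;> omega
  · have hx : (⟨c.1 + c.2, by omega⟩ : Fin n) ∈ D :=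
      hoc v hv w hw _ (by rw [Fin.le_def]; simp; omega) (by rw [Fin.le_def]; simp; omega)
    obtain ⟨d, hd, h1, h2⟩ := mem_toSt.1 (hDL hx)
    simp only at h1 h2
    rcases h.sep hc hd with rfl | h3 | h3 <;> omega

theorem mem_comps {n : ℕ} {L : List (ℕ × ℕ)} (h : PValid 0 L (n + 1)) (C : Finset (Fin n)) :
    C ∈ comps (SimpleGraph.pathGraph n) (toSt n L) ↔ ∃ c ∈ L, ivl n c = C := by
  have hsub : ∀ c ∈ L, ivl n c ⊆ toSt n L := fun c hc v hv =>
    mem_toSt.2 ⟨c, hc, mem_ivl.1 hv⟩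
  have hconn : ∀ c ∈ L, IsConnSub (SimpleGraph.pathGraph n) (ivl n c) := fun c hc => by
    have := h.mem hc
    exact conn_ivl this.2.1 (by omega)
  simp only [comps, Finset.mem_filter, Finset.mem_univ, true_and]
  constructor
  · rintro ⟨h1, h2, h3⟩
    obtain ⟨v, hv⟩ := (interval_conn h2).1
    obtain ⟨c, hc, hcv⟩ := mem_toSt.1 (h1 hv)
    exact ⟨c, hc, h3 _ (ivl_absorb h hc h2 h1 hv (mem_ivl.2 hcv)) (hsub c hc) (hconn c hc)⟩
  · rintro ⟨c, hc, rfl⟩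
    refine ⟨hsub c hc, hconn c hc, fun D h1 h2 h3 => ?_⟩
    obtain ⟨v, hv⟩ := (interval_conn (hconn c hc)).1
    exact Finset.Subset.antisymm (ivl_absorb h hc h3 h2 (h1 hv) hv) h1

theorem card_ivl {n : ℕ} {c : ℕ × ℕ} (h2 : c.1 + c.2 ≤ n) : (ivl n c).card = c.2 := by
  have : (ivl n c).map Fin.valEmbedding = Finset.Ico c.1 (c.1 + c.2) := by
    ext x
    simp only [Finset.mem_map, mem_ivl, Fin.valEmbedding_apply, Finset.mem_Ico]
    constructor
    · rintro ⟨v, hv, rfl⟩; exact hv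
    · intro hx; exact ⟨⟨x, by omega⟩, hx, rfl⟩
  rw [← Finset.card_map Fin.valEmbedding, this]
  simp

theorem min_ivl {n : ℕ} {c : ℕ × ℕ} (h1 : 1 ≤ c.2) (h2 : c.1 + c.2 ≤ n) :
    (ivl n c).min = ((⟨c.1, by omega⟩ : Fin n) : WithTop (Fin n)) := by
  apply le_antisymm
  · apply Finset.min_le
    rw [mem_ivl]; simp; omega
  · apply Finset.le_min
    intro a ha
    rw [mem_ivl] at ha
    exact WithTop.coe_le_coe.2 (Fin.le_def.2 ha.1)

theorem ivl_inj {n : ℕ} {c d : ℕ × ℕ} (h1 : 1 ≤ c.2) (h2 : c.1 + c.2 ≤ n)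
    (h3 : 1 ≤ d.2) (h4 : d.1 + d.2 ≤ n) (h : ivl n c = ivl n d) : c = d := by
  have e1 := card_ivl h2
  rw [h, card_ivl h4] at e1
  have e2 := min_ivl h1 h2
  rw [h, min_ivl h3 h4] at e2
  have := Fin.mk.inj (WithTop.coe_injective e2)
  exact Prod.ext this.symm e1.symm

theorem exists_list_aux {n : ℕ} (U : Finset (Fin n)) (d : ℕ) : ∀ a, a + d = n →
    ∃ L, PValid a L (n + 1) ∧ ∀ v : Fin n, (v ∈ U ∧ a ≤ v.1) ↔
      ∃ c ∈ L, c.1 ≤ v.1 ∧ v.1 < c.1 + c.2 := by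
  induction d with
  | zero =>
    intro a ha
    refine ⟨[], by simp [PValid]; omega, fun v => ?_⟩
    simp
    intro _
    have := v.2
    omega
  | succ d ih =>
    intro a ha
    obtain ⟨L, hL, hU⟩ := ih (a + 1) (by omega)
    have han : a < n := by omega
    by_cases hmem : (⟨a, han⟩ : Fin n) ∈ U
    · have hav : ∀ v : Fin n, (v ∈ U ∧ a ≤ v.1) ↔ (v.1 = a ∨ (v ∈ U ∧ a + 1 ≤ v.1)) := by
        intro v
        constructor
        · rintro ⟨h1, h2⟩
          by_cases e : v.1 = a
          · exact Or.inl e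
          · exact Or.inr ⟨h1, by omega⟩
        · rintro (e | h)
          · have : v = ⟨a, han⟩ := Fin.ext e
            exact ⟨this ▸ hmem, by omega⟩
          · exact ⟨h.1, by omega⟩
      by_cases hh : ∃ l L', L = (a + 1, l) :: L'
      · obtain ⟨l, L', rfl⟩ := hh
        simp only [PValid] at hL
        refine ⟨(a, l + 1) :: L', ?_, fun v => ?_⟩
        · simp only [PValid]
          refine ⟨le_rfl, by omega, hL.2.2.mono_left (by omega)⟩
        · rw [hav, hU]
          simp only [List.mem_cons, exists_eq_or_imp]
          constructor
          · rintro (h | h | h)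
            · left; omega
            · left; omega
            · right; exact h
          · rintro (h | h)
            · by_cases e : v.1 = a
              · exact Or.inl e
              · right; left; omega
            · exact Or.inr (Or.inr h)
      · refine ⟨(a, 1) :: L, ?_, fun v => ?_⟩
        · simp only [PValid]
          refine ⟨le_rfl, le_rfl, ?_⟩
          cases L with
          | nil => simp only [PValid]; omega
          | cons c L' =>
            simp only [PValid] at hL ⊢
            refine ⟨?_, hL.2⟩
            by_contra hc
            exact hh ⟨c.2, L', by rw [show (a + 1, c.2) = c from Prod.ext (by simp; omega) rfl]⟩
        · rw [hav, hU]
          simp only [List.mem_cons, exists_eq_or_imp]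
          apply or_congr _ Iff.rfl
          omega
    · refine ⟨L, hL.mono_left (by omega), fun v => ?_⟩
      rw [← hU]
      refine and_congr_right fun hv => ?_
      have : v.1 ≠ a := fun e => hmem (by rw [← show v = ⟨a, han⟩ from Fin.ext e]; exact hv)
      omega

theorem exists_list {n : ℕ} (U : Finset (Fin n)) : ∃ L, PValid 0 L (n + 1) ∧ U = toSt n L := by
  obtain ⟨L, h1, h2⟩ := exists_list_aux U n 0 (by omega)
  refine ⟨L, h1, ?_⟩
  ext v
  rw [mem_toSt, ← h2]
  simp

theorem ivl_injOn {n : ℕ} {L M : List (ℕ × ℕ)} (h : PValid 0 L (n + 1)) (h' : PValid 0 M (n + 1))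
    {c d : ℕ × ℕ} (hc : c ∈ L) (hd : d ∈ M) (e : ivl n c = ivl n d) : c = d := by
  have := h.mem hc
  have := h'.mem hd
  exact ivl_inj (by omega) (by omega) (by omega) (by omega) e

theorem comps_val {n : ℕ} {L : List (ℕ × ℕ)} (h : PValid 0 L (n + 1)) :
    (comps (SimpleGraph.pathGraph n) (toSt n L)).val = ((L.map (ivl n) : List _) : Multiset _) := by
  refine (Multiset.Nodup.ext (Finset.nodup _) ?_).2 ?_
  · rw [Multiset.coe_nodup]
    refine (List.nodup_map_iff_inj_on h.nodup).2 ?_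
    intro c hc d hd e
    exact ivl_injOn h h hc hd e
  · intro C
    rw [Finset.mem_val, mem_comps h]
    simp

theorem cc_toSt {n : ℕ} {L : List (ℕ × ℕ)} (h : PValid 0 L (n + 1)) :
    ccMultiset (SimpleGraph.pathGraph n) (toSt n L) = ((L.map Prod.snd : List ℕ) : Multiset ℕ) := by
  unfold ccMultiset
  rw [comps_val h, Multiset.map_coe, List.map_map]
  congr 1
  apply List.map_congr_left
  intro c hc
  have := h.mem hc
  exact card_ivl (by omega)

theorem card_comps {n : ℕ} {L : List (ℕ × ℕ)} (h : PValid 0 L (n + 1)) :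
    (comps (SimpleGraph.pathGraph n) (toSt n L)).card = L.length := by
  rw [Finset.card_def, comps_val h]
  simp

theorem card_toSt {n : ℕ} {L : List (ℕ × ℕ)} {a : ℕ} (h : PValid a L (n + 1)) :
    (toSt n L).card = (L.map Prod.snd).sum := by
  induction L generalizing a with
  | nil => simp [toSt]
  | cons c L ih =>
    have hm := h.mem (List.mem_cons_self)
    simp only [PValid] at h
    have e : toSt n (c :: L) = ivl n c ∪ toSt n L := by
      ext v
      simp [mem_toSt, mem_ivl]
    rw [e, Finset.card_union_of_disjoint, ih h.2.2, card_ivl (by omega)]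
    · simp
    · rw [Finset.disjoint_left]
      intro v hv hv'
      rw [mem_ivl] at hv
      obtain ⟨d, hd, h1, h2⟩ := mem_toSt.1 hv'
      have := h.2.2.mem hd
      omega

theorem hseq_toSt {n : ℕ} {L : List (ℕ × ℕ)} (h : PValid 0 L (n + 1)) :
    hseq n (toSt n L) = L.map Prod.snd := by
  have hs : ((comps (SimpleGraph.pathGraph n) (toSt n L)).image (fun C => C.min)).sort (· ≤ ·)
      = L.map (fun c => (ivl n c).min) := by
    have hp : (L.map (fun c => (ivl n c).min)).Pairwise (· < ·) := by
      rw [List.pairwise_map]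
      refine List.Pairwise.imp_of_mem ?_ h.pairwise
      intro c d hc hd hcd
      have h1 := h.mem hc
      have h2 := h.mem hd
      rw [min_ivl h1.2.1 (by omega), min_ivl h2.2.1 (by omega)]
      exact WithTop.coe_lt_coe.2 (Fin.lt_def.2 (by simp; omega))
    have e : (comps (SimpleGraph.pathGraph n) (toSt n L)).image (fun C => C.min)
        = (L.map (fun c => (ivl n c).min)).toFinset := by
      ext x
      simp [mem_comps h]
    rw [e]
    exact (List.toFinset_sort (· ≤ ·) (hp.imp ne_of_lt)).2 (hp.imp le_of_lt)
  unfold hseq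
  rw [hs, List.map_map]
  apply List.map_congr_left
  intro c hc
  have h1 := h.mem hc
  have e : (comps (SimpleGraph.pathGraph n) (toSt n L)).filter
      (fun C => C.min = (ivl n c).min) = {ivl n c} := by
    ext C
    simp only [Finset.mem_filter, mem_comps h, Finset.mem_singleton]
    constructor
    · rintro ⟨⟨d, hd, rfl⟩, e⟩
      have h2 := h.mem hd
      rw [min_ivl h1.2.1 (by omega), min_ivl h2.2.1 (by omega)] at e
      have := Fin.mk.inj (WithTop.coe_injective e)
      rcases h.sep hc hd with rfl | h3 | h3
      · rfl
      · omega
      · omega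
    · rintro rfl
      exact ⟨⟨c, hc, rfl⟩, rfl⟩
  simp only [Function.comp]
  rw [e, Finset.sup_singleton, card_ivl (by omega)]

/-! steps -/

theorem mem_mid {α : Type*} {L1 L2 : List α} {c d : α} :
    d ∈ L1 ++ c :: L2 ↔ d = c ∨ d ∈ L1 ++ L2 := by
  simp only [List.mem_append, List.mem_cons]
  tauto

theorem notMem_mid {α : Type*} {L1 L2 : List α} {c : α} (h : (L1 ++ c :: L2).Nodup) :
    c ∉ L1 ++ L2 := by
  have := (List.perm_middle (a := c) (l₁ := L1) (l₂ := L2)).nodup_iff.1 h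
  exact (List.nodup_cons.1 this).1

theorem sdiff_single {n : ℕ} {L1 L2 M1 M2 : List (ℕ × ℕ)} {c c' : ℕ × ℕ}
    (h : PValid 0 (L1 ++ c :: L2) (n + 1)) (h' : PValid 0 (M1 ++ c' :: M2) (n + 1))
    (e : L1 ++ L2 = M1 ++ M2) (hne : c ≠ c') :
    (comps (SimpleGraph.pathGraph n) (toSt n (L1 ++ c :: L2)) \
      comps (SimpleGraph.pathGraph n) (toSt n (M1 ++ c' :: M2))).card = 1 := by
  rw [Finset.card_eq_one]
  refine ⟨ivl n c, ?_⟩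
  ext C
  rw [Finset.mem_sdiff, mem_comps h, mem_comps h', Finset.mem_singleton]
  constructor
  · rintro ⟨⟨d, hd, rfl⟩, h2⟩
    rcases mem_mid.1 hd with rfl | hd
    · rfl
    · exact absurd ⟨d, mem_mid.2 (Or.inr (e ▸ hd)), rfl⟩ h2
  · rintro rfl
    refine ⟨⟨c, mem_mid.2 (Or.inl rfl), rfl⟩, ?_⟩
    rintro ⟨d, hd, hdc⟩
    have := ivl_injOn h' h hd (mem_mid.2 (Or.inl rfl)) hdc
    subst this
    rcases mem_mid.1 hd with h3 | h3
    · exact hne h3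
    · rw [← e] at h3
      exact notMem_mid h.nodup h3

theorem step_reach {n : ℕ} {L1 L2 M1 M2 : List (ℕ × ℕ)} {c c' : ℕ × ℕ}
    (h : PValid 0 (L1 ++ c :: L2) (n + 1)) (h' : PValid 0 (M1 ++ c' :: M2) (n + 1))
    (e : L1 ++ L2 = M1 ++ M2) (hc : c.2 = c'.2) :
    Relation.ReflTransGen (adjCJ (SimpleGraph.pathGraph n))
      (toSt n (L1 ++ c :: L2)) (toSt n (M1 ++ c' :: M2)) := by
  by_cases hne : c = c'
  · subst hne
    have : toSt n (L1 ++ c :: L2) = toSt n (M1 ++ c :: M2) := by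
      ext v
      simp only [mem_toSt, mem_mid, e]
    rw [this]
  · refine Relation.ReflTransGen.single ⟨?_, sdiff_single h h' e hne,
      sdiff_single h' h e.symm (Ne.symm hne)⟩
    rw [cc_toSt h, cc_toSt h', Multiset.coe_eq_coe]
    have p1 := (List.perm_middle (a := c) (l₁ := L1) (l₂ := L2)).map Prod.snd
    have p2 := (List.perm_middle (a := c') (l₁ := M1) (l₂ := M2)).map Prod.snd
    refine p1.trans (List.Perm.trans ?_ p2.symm)
    rw [e, List.map_cons, List.map_cons, hc]

theorem rch_symm {n : ℕ} {U V : Finset (Fin n)}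
    (h : Relation.ReflTransGen (adjCJ (SimpleGraph.pathGraph n)) U V) :
    Relation.ReflTransGen (adjCJ (SimpleGraph.pathGraph n)) V U := by
  induction h with
  | refl => exact Relation.ReflTransGen.refl
  | tail _ hbc ih =>
    exact Relation.ReflTransGen.head ⟨hbc.1.symm, hbc.2.2, hbc.2.1⟩ ih

def pck : ℕ → List ℕ → List (ℕ × ℕ)
  | _, [] => []
  | a, x :: h => (a, x) :: pck (a + x + 1) h

theorem pck_snd (a : ℕ) (h : List ℕ) : (pck a h).map Prod.snd = h := by
  induction h generalizing a with
  | nil => rfl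
  | cons x h ih => simp [pck, ih]

theorem pck_valid {a m : ℕ} {h : List ℕ} (hp : ∀ x ∈ h, 1 ≤ x)
    (hs : a + (h.map (· + 1)).sum ≤ m) : PValid a (pck a h) m := by
  induction h generalizing a with
  | nil => simpa [pck, PValid] using hs
  | cons x h ih =>
    simp only [List.map_cons, List.sum_cons] at hs
    simp only [pck, PValid]
    refine ⟨le_rfl, hp x (by simp), ih (fun y hy => hp y (by simp [hy])) (by omega)⟩

theorem pack_reach {n a : ℕ} {P L : List (ℕ × ℕ)} (hP : PValid 0 P a) (hL : PValid a L (n + 1)) :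
    Relation.ReflTransGen (adjCJ (SimpleGraph.pathGraph n))
      (toSt n (P ++ L)) (toSt n (P ++ pck a (L.map Prod.snd))) := by
  induction L generalizing a P with
  | nil => simpa [pck] using Relation.ReflTransGen.refl
  | cons c L ih =>
    simp only [PValid] at hL
    have hL' : PValid (a + c.2 + 1) L (n + 1) := hL.2.2.mono_left (by omega)
    have h1 : PValid 0 (P ++ c :: L) (n + 1) := pvalid_append.2 ⟨a, hP, hL⟩
    have h2 : PValid 0 (P ++ (a, c.2) :: L) (n + 1) :=
      pvalid_append.2 ⟨a, hP, le_rfl, hL.2.1, hL'⟩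
    refine (step_reach h1 h2 rfl rfl).trans ?_
    have h3 : PValid 0 (P ++ [(a, c.2)]) (a + c.2 + 1) :=
      pvalid_append.2 ⟨a, hP, le_rfl, hL.2.1, by simp [PValid]⟩
    have := ih h3 hL'
    simpa [pck] using this

theorem same_reach {n : ℕ} {L M : List (ℕ × ℕ)} (hL : PValid 0 L (n + 1))
    (hM : PValid 0 M (n + 1)) (e : L.map Prod.snd = M.map Prod.snd) :
    Relation.ReflTransGen (adjCJ (SimpleGraph.pathGraph n)) (toSt n L) (toSt n M) := by
  have h1 := pack_reach (P := []) (a := 0) (by simp [PValid]) hL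
  have h2 := pack_reach (P := []) (a := 0) (by simp [PValid]) hM
  rw [e] at h1
  exact Relation.ReflTransGen.trans h1 (rch_symm h2)

/-- reachability of canonical configurations -/
def HR (n : ℕ) (h h' : List ℕ) : Prop :=
  Relation.ReflTransGen (adjCJ (SimpleGraph.pathGraph n)) (toSt n (pck 0 h)) (toSt n (pck 0 h'))

theorem hr_swap {n x y : ℕ} {p q : List ℕ} (hp : ∀ z ∈ p ++ x :: y :: q, 1 ≤ z)
    (hs : ((p ++ x :: y :: q).map (· + 1)).sum + x ≤ n) :
    HR n (p ++ x :: y :: q) (p ++ y :: x :: q) := by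
  have hp1 : ∀ z ∈ p, 1 ≤ z := fun z hz => hp z (by simp [hz])
  have hq1 : ∀ z ∈ q, 1 ≤ z := fun z hz => hp z (by simp [hz])
  have hx1 : 1 ≤ x := hp x (by simp)
  have hy1 : 1 ≤ y := hp y (by simp)
  have hv : PValid 0 (pck 0 (p ++ x :: y :: q)) (n + 1) := pck_valid hp (by omega)
  have hv' : PValid 0 (pck 0 (p ++ y :: x :: q)) (n + 1) := by
    refine pck_valid ?_ ?_
    · intro z hz
      apply hp z
      simp only [List.mem_append, List.mem_cons] at hz ⊢
      tauto
    · simp only [List.map_append, List.map_cons, List.sum_append, List.sum_cons] at hs ⊢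
      omega
  simp only [List.map_append, List.map_cons, List.sum_append, List.sum_cons] at hs
  set a := (p.map (· + 1)).sum with ha
  have hpv : PValid 0 (pck 0 p) a := pck_valid hp1 (by omega)
  have hqv : PValid (a + x + 1 + y + 1 + x + 1) (pck (a + x + 1 + y + 1 + x + 1) q) (n + 1) :=
    pck_valid hq1 (by omega)
  have v1 : PValid 0 (pck 0 p ++ (a, x) :: (a + x + 1, y) ::
      pck (a + x + 1 + y + 1 + x + 1) q) (n + 1) := by
    refine pvalid_append.2 ⟨a, hpv, le_rfl, hx1, le_rfl, hy1, hqv.mono_left ?_⟩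
    simp only; omega
  have v2 : PValid 0 ((pck 0 p ++ [(a + x + 1, y)]) ++ (a + x + 1 + y + 1, x) ::
      pck (a + x + 1 + y + 1 + x + 1) q) (n + 1) := by
    rw [List.append_assoc]
    refine pvalid_append.2 ⟨a, hpv, ?_, hy1, le_rfl, hx1, hqv.mono_left ?_⟩
    · simp only; omega
    · simp only; omega
  have r1 := step_reach v1 v2 (by simp) rfl
  refine (same_reach hv v1 ?_).trans (r1.trans (same_reach v2 hv' ?_))
  · simp [pck_snd]
  · simp [pck_snd]

/-- swaps -/
inductive Sw (b : ℕ) : List ℕ → List ℕ → Prop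
  | refl (l) : Sw b l l
  | swap (x y l) : min x y ≤ b → Sw b (x :: y :: l) (y :: x :: l)
  | cons (x l l') : Sw b l l' → Sw b (x :: l) (x :: l')
  | trans (l l' l'') : Sw b l l' → Sw b l' l'' → Sw b l l''

theorem Sw.perm {b : ℕ} {l l' : List ℕ} (h : Sw b l l') : l.Perm l' := by
  induction h with
  | refl => exact List.Perm.refl _
  | swap x y l => exact List.Perm.swap _ _ _
  | cons x l l' _ ih => exact ih.cons _
  | trans l l' l'' _ _ ih1 ih2 => exact ih1.trans ih2

theorem Sw.symm {b : ℕ} {l l' : List ℕ} (h : Sw b l l') : Sw b l' l := by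
  induction h with
  | refl => exact Sw.refl _
  | swap x y l h => exact Sw.swap _ _ _ (by rwa [min_comm])
  | cons x l l' _ ih => exact ih.cons _
  | trans l l' l'' _ _ ih1 ih2 => exact ih2.trans _ _ _ ih1

theorem Sw.small {b : ℕ} {l l' : List ℕ} (h : l.Perm l') (hl : ∀ x ∈ l, x ≤ b) : Sw b l l' := by
  induction h with
  | nil => exact Sw.refl _
  | cons x _ ih => exact (ih (fun y hy => hl y (by simp [hy]))).cons _
  | swap x y l => exact Sw.swap _ _ _ (min_le_of_left_le (hl _ (by simp)))
  | trans h1 h2 ih1 ih2 => exact (ih1 hl).trans _ _ _ (ih2 (fun y hy => hl y (h1.mem_iff.2 hy)))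

theorem Sw.append {b : ℕ} {l l' m : List ℕ} (h : Sw b l l') : Sw b (l ++ m) (l' ++ m) := by
  induction h with
  | refl => exact Sw.refl _
  | swap x y l h => exact Sw.swap _ _ _ h
  | cons x l l' _ ih => exact ih.cons _
  | trans l l' l'' _ _ ih1 ih2 => exact ih1.trans _ _ _ ih2

theorem Sw.push {b x : ℕ} {s t : List ℕ} (hs : ∀ y ∈ s, y ≤ b) :
    Sw b (x :: (s ++ t)) (s ++ x :: t) := by
  induction s with
  | nil => exact Sw.refl _
  | cons y s ih =>
    refine Sw.trans _ _ _ (Sw.swap x y _ (min_le_of_right_le (hs y (by simp)))) ?_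
    exact (ih (fun z hz => hs z (by simp [hz]))).cons _

theorem Sw.normal {b : ℕ} (l : List ℕ) :
    Sw b l (l.filter (· ≤ b) ++ l.filter (b < ·)) := by
  induction l with
  | nil => exact Sw.refl _
  | cons x l ih =>
    by_cases hx : x ≤ b
    · have : ¬ b < x := by omega
      simp only [List.filter_cons, hx, this, decide_true, decide_false, if_true]
      exact ih.cons _
    · have h2 : b < x := by omega
      simp only [List.filter_cons, hx, h2, decide_true, decide_false, if_true]
      refine (ih.cons x).trans _ _ _ (Sw.push ?_)
      intro y hy
      simpa using (List.mem_filter.1 hy).2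

theorem Sw.of_filter {b : ℕ} {l l' : List ℕ} (hp : l.Perm l')
    (hf : l.filter (b < ·) = l'.filter (b < ·)) : Sw b l l' := by
  refine (Sw.normal l).trans _ _ _ (Sw.trans _ _ _ ?_ (Sw.normal l').symm)
  rw [hf]
  refine Sw.append (Sw.small (hp.filter _) ?_)
  intro y hy
  simpa using (List.mem_filter.1 hy).2

theorem Sw.reach {b n : ℕ} {l l' : List ℕ} (h : Sw b l l') : ∀ p : List ℕ,
    (∀ z ∈ p ++ l, 1 ≤ z) → (∀ z, 1 ≤ z → z ≤ b → ((p ++ l).map (· + 1)).sum + z ≤ n) →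
    HR n (p ++ l) (p ++ l') := by
  induction h with
  | refl => intro p _ _; exact Relation.ReflTransGen.refl
  | swap x y l h =>
    intro p h1 h2
    rcases min_le_iff.1 h with hx | hy
    · exact hr_swap h1 (h2 x (h1 x (by simp)) hx)
    · refine rch_symm (hr_swap ?_ ?_)
      · intro z hz
        apply h1 z
        simp only [List.mem_append, List.mem_cons] at hz ⊢
        tauto
      · have := h2 y (h1 y (by simp)) hy
        simp only [List.map_append, List.map_cons, List.sum_append, List.sum_cons] at this ⊢
        omega
  | cons x l l' _ ih =>
    intro p h1 h2
    have := ih (p ++ [x]) (by simpa using h1) (by simpa using h2)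
    simpa using this
  | trans l l' l'' hl hl' ih1 ih2 =>
    intro p h1 h2
    have pp : (p ++ l).Perm (p ++ l') := hl.perm.append_left p
    refine Relation.ReflTransGen.trans (ih1 p h1 h2) (ih2 p ?_ ?_)
    · intro z hz
      exact h1 z (pp.mem_iff.2 hz)
    · rw [← (pp.map (· + 1)).sum_eq]
      exact h2

/-! necessity -/

theorem jump_bound {n : ℕ} {L1 T M2 : List (ℕ × ℕ)} {c c' t : ℕ × ℕ}
    (h : PValid 0 (L1 ++ c :: (t :: T ++ M2)) (n + 1))
    (h' : PValid 0 ((L1 ++ t :: T) ++ c' :: M2) (n + 1)) (hc : c.2 = c'.2) :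
    wsum (L1 ++ c :: (t :: T ++ M2)) + c.2 ≤ n := by
  obtain ⟨e, h1, h2⟩ := pvalid_append.1 h
  obtain ⟨e', h1', h2'⟩ := pvalid_append.1 h'
  obtain ⟨e'', h3, h4⟩ := pvalid_append.1 h1'
  simp only [PValid, List.cons_append] at h2 h2' h4
  have a1 := h1.bound
  have a2 := h2'.2.2.bound
  have a3 := h4.2.2.bound
  simp only [wsum_append, wsum_cons, List.cons_append]
  omega

theorem adj_filter_aux {n : ℕ} {L1 L2 M1 M2 : List (ℕ × ℕ)} {c c' : ℕ × ℕ}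
    (h : PValid 0 (L1 ++ c :: L2) (n + 1)) (h' : PValid 0 (M1 ++ c' :: M2) (n + 1))
    (e : L1 ++ L2 = M1 ++ M2) (hc : c.2 = c'.2) (hlen : L1.length ≤ M1.length) :
    c.2 + wsum (L1 ++ c :: L2) ≤ n ∨
      (L1 ++ c :: L2).map Prod.snd = (M1 ++ c' :: M2).map Prod.snd := by
  rcases List.append_eq_append_iff.1 e with ⟨as, h1, h2⟩ | ⟨as, h1, h2⟩
  · cases as with
    | nil =>
      right
      simp only [List.append_nil, List.nil_append] at h1 h2
      subst h1 h2
      simp [hc]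
    | cons t T =>
      subst h1 h2
      left
      have := jump_bound h h' hc
      omega
  · have : as = [] := by
      have := congrArg List.length h1
      rw [List.length_append] at this
      exact List.length_eq_zero_iff.1 (by omega)
    subst this
    right
    simp only [List.append_nil, List.nil_append] at h1 h2
    subst h1 h2
    simp [hc]

theorem wsum_perm {L M : List (ℕ × ℕ)} (h : (L.map Prod.snd).Perm (M.map Prod.snd)) :
    wsum L = wsum M := by
  have := (h.map (· + 1)).sum_eq
  simpa [wsum, Function.comp_def] using this

theorem adj_filter {n b : ℕ} {L M : List (ℕ × ℕ)} (hL : PValid 0 L (n + 1))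
    (hM : PValid 0 M (n + 1)) (hadj : adjCJ (SimpleGraph.pathGraph n) (toSt n L) (toSt n M))
    (hb : ∀ z, b < z → n < z + wsum L) :
    (L.map Prod.snd).filter (b < ·) = (M.map Prod.snd).filter (b < ·) := by
  obtain ⟨hcc, hd1, hd2⟩ := hadj
  rw [cc_toSt hL, cc_toSt hM, Multiset.coe_eq_coe] at hcc
  obtain ⟨C, hC⟩ := Finset.card_eq_one.1 hd1
  obtain ⟨C', hC'⟩ := Finset.card_eq_one.1 hd2
  have hC1 : ∀ X, X = C ↔ _ := fun X => by rw [← Finset.mem_singleton, ← hC, Finset.mem_sdiff, mem_comps hL, mem_comps hM]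
  have hC2 : ∀ X, X = C' ↔ _ := fun X => by rw [← Finset.mem_singleton, ← hC', Finset.mem_sdiff, mem_comps hL, mem_comps hM]
  obtain ⟨⟨c, hcL, hcC⟩, hcM⟩ := (hC1 C).1 rfl
  obtain ⟨⟨c', hcM', hcC'⟩, hcL'⟩ := (hC2 C').1 rfl
  obtain ⟨L1, L2, rfl⟩ := List.append_of_mem hcL
  obtain ⟨M1, M2, rfl⟩ := List.append_of_mem hcM'
  have hcnM : c ∉ M1 ++ c' :: M2 := fun h => hcM ⟨c, h, hcC⟩
  have hcnL : c' ∉ L1 ++ c :: L2 := fun h => hcL' ⟨c', h, hcC'⟩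
  have sL : (L1 ++ L2).Sublist (L1 ++ c :: L2) := (List.sublist_cons_self c L2).append_left L1
  have sM : (M1 ++ M2).Sublist (M1 ++ c' :: M2) := (List.sublist_cons_self c' M2).append_left M1
  have hmem : ∀ d, d ∈ L1 ++ L2 ↔ d ∈ M1 ++ M2 := by
    intro d
    constructor
    · intro hd
      have hne : d ≠ c := fun e => notMem_mid hL.nodup (e ▸ hd)
      by_contra hcon
      have : d ∉ M1 ++ c' :: M2 := by
        intro h2
        rcases mem_mid.1 h2 with rfl | h3
        · exact hcnL (sL.subset hd)
        · exact hcon h3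
      refine hne (ivl_injOn hL hL (sL.subset hd) hcL ?_)
      rw [hcC, hC1]
      refine ⟨⟨d, sL.subset hd, rfl⟩, ?_⟩
      rintro ⟨x, hx, hxd⟩
      exact this (ivl_injOn hM hL hx (sL.subset hd) hxd ▸ hx)
    · intro hd
      have hne : d ≠ c' := fun e => notMem_mid hM.nodup (e ▸ hd)
      by_contra hcon
      have : d ∉ L1 ++ c :: L2 := by
        intro h2
        rcases mem_mid.1 h2 with rfl | h3
        · exact hcnM (sM.subset hd)
        · exact hcon h3
      refine hne (ivl_injOn hM hM (sM.subset hd) hcM' ?_)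
      rw [hcC', hC2]
      refine ⟨⟨d, sM.subset hd, rfl⟩, ?_⟩
      rintro ⟨x, hx, hxd⟩
      exact this (ivl_injOn hL hM hx (sM.subset hd) hxd ▸ hx)
  have hperm : (L1 ++ L2).Perm (M1 ++ M2) :=
    (List.perm_ext_iff_of_nodup (hL.nodup.sublist sL) (hM.nodup.sublist sM)).2 hmem
  have e : L1 ++ L2 = M1 ++ M2 := by
    refine hperm.eq_of_pairwise ?_ (hL.pairwise.sublist sL) (hM.pairwise.sublist sM)
    intro x y _ _ h1 h2
    omega
  have hc : c.2 = c'.2 := by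
    have p1 := (List.perm_middle (a := c) (l₁ := L1) (l₂ := L2)).map Prod.snd
    have p2 := (List.perm_middle (a := c') (l₁ := M1) (l₂ := M2)).map Prod.snd
    have := (p1.symm.trans (hcc.trans p2)).sum_eq
    rw [e] at this
    simpa using this
  by_cases hcb : b < c.2
  · have hbig := hb c.2 hcb
    have hw := wsum_perm hcc
    rcases le_total L1.length M1.length with hl | hl
    · rcases adj_filter_aux hL hM e hc hl with h | h
      · omega
      · rw [h]
    · rcases adj_filter_aux hM hL e.symm hc.symm hl with h | h
      · omega
      · rw [h]
  · have hcb' : ¬ b < c'.2 := by omega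
    simp only [List.map_append, List.map_cons, List.filter_append, List.filter_cons, hcb, hcb',
      decide_false]
    have := congrArg (fun l => (l.map Prod.snd).filter (b < ·)) e
    simpa using this

/-! inversions -/

def IsPos (h : List ℕ) (v c q : ℕ) : Prop :=
  ∃ l1 l2, h = l1 ++ v :: l2 ∧ l1.length = q ∧ l1.count v + 1 = c

theorem isPos_iff {h : List ℕ} {v c q : ℕ} :
    IsPos h v c q ↔ q < h.length ∧ h.getD q 0 = v ∧ (h.take (q + 1)).count v = c := by
  constructor
  · rintro ⟨l1, l2, rfl, rfl, rfl⟩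
    refine ⟨by simp, by simp, ?_⟩
    simp [List.take_append, List.take_of_length_le]
  · rintro ⟨h1, h2, h3⟩
    have e : h[q] = v := by rw [← h2, List.getD_eq_getElem _ _ h1]
    refine ⟨h.take q, h.drop (q + 1), ?_, by simp; omega, ?_⟩
    · rw [← e, List.getElem_cons_drop, List.take_append_drop]
    · rw [← h3, ← List.take_append_getElem h1, e]
      simp

theorem IsPos.take {h : List ℕ} {v c q : ℕ} (hp : IsPos h v c q) {r : ℕ} (hr : q < r) :
    (∃ s, h.take r = h.take q ++ v :: s) ∧ (h.take q).count v + 1 = c := by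
  obtain ⟨l1, l2, rfl, rfl, rfl⟩ := hp
  refine ⟨⟨l2.take (r - l1.length - 1), ?_⟩, by simp⟩
  rw [List.take_append, List.take_left', List.take_of_length_le (by omega)]
  · congr 1
    obtain ⟨d, hd⟩ : ∃ d, r - l1.length = d + 1 := ⟨r - l1.length - 1, by omega⟩
    rw [hd]; simp
  · rfl

theorem IsPos.take_count {h : List ℕ} {v c q : ℕ} (hp : IsPos h v c q) {r : ℕ} (hr : q < r) :
    c ≤ (h.take r).count v := by
  obtain ⟨⟨s, hs⟩, h2⟩ := hp.take hr
  rw [hs]; simp; omega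

theorem IsPos.le_of_count {h : List ℕ} {v c q : ℕ} (hp : IsPos h v c q) {r : ℕ}
    (hr : (h.take r).count v < c) : r ≤ q := by
  by_contra hcon
  have := hp.take_count (r := r) (by omega)
  omega

theorem IsPos.unique {h : List ℕ} {v c q r : ℕ} (hp : IsPos h v c q) (hq : IsPos h v c r) :
    q = r := by
  have h1 := (hp.take (Nat.lt_succ_self q)).2
  have h2 := (hq.take (Nat.lt_succ_self r)).2
  apply le_antisymm
  · exact hq.le_of_count (by omega)
  · exact hp.le_of_count (by omega)

theorem IsPos.val {h : List ℕ} {v w c d q : ℕ} (hp : IsPos h v c q) (hq : IsPos h w d q) :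
    v = w := by
  rw [isPos_iff] at hp hq
  rw [← hp.2.1, hq.2.1]

theorem exists_pos {h : List ℕ} {v c : ℕ} (h1 : 1 ≤ c) (h2 : c ≤ h.count v) :
    ∃ q, IsPos h v c q := by
  induction h generalizing c with
  | nil => simp at h2; omega
  | cons y h ih =>
    by_cases e : y = v
    · subst e
      by_cases hc : c = 1
      · subst hc
        exact ⟨0, [], h, rfl, rfl, by simp⟩
      · obtain ⟨q, l1, l2, rfl, rfl, h3⟩ := ih (c := c - 1) (by omega) (by simp at h2; omega)
        refine ⟨_, y :: l1, l2, rfl, rfl, ?_⟩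
        simp; omega
    · rw [List.count_cons_of_ne e] at h2
      obtain ⟨q, l1, l2, rfl, rfl, h3⟩ := ih h1 h2
      refine ⟨_, y :: l1, l2, rfl, rfl, ?_⟩
      rw [List.count_cons_of_ne e, h3]

theorem match_spec {hA hB : List ℕ} (hp : hA.Perm hB) {v c p : ℕ} (h : IsPos hA v c p) :
    IsPos hB v c (matchIdx hA hB p) := by
  obtain ⟨h1, h2, h3⟩ := isPos_iff.1 h
  have hc1 : 1 ≤ c := by
    obtain ⟨l1, l2, _, _, h⟩ := h
    omega
  have hc2 : c ≤ hB.count v := by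
    rw [← hp.count_eq, ← h3]
    exact (List.take_sublist _ _).count_le _
  obtain ⟨q, hq⟩ := exists_pos hc1 hc2
  unfold matchIdx
  rw [h2, h3]
  rcases hf : (List.range hB.length).find? (fun q =>
    decide (hB.getD q 0 = v ∧ (hB.take (q + 1)).count v = c)) with _ | r
  · rw [List.find?_eq_none] at hf
    rw [isPos_iff] at hq
    have := hf q (by simpa using hq.1)
    simp only [decide_eq_true_eq] at this
    exact absurd hq.2 this
  · have m := List.mem_of_find?_eq_some hf
    have s := List.find?_some hf
    rw [isPos_iff]
    simp only [decide_eq_true_eq] at s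
    exact ⟨by simpa using m, s⟩

theorem pos_filter {b : ℕ} {h : List ℕ} {v c q : ℕ} (hp : IsPos h v c q) (hv : b < v) :
    IsPos (h.filter (b < ·)) v c ((h.take q).filter (b < ·)).length := by
  obtain ⟨l1, l2, rfl, rfl, rfl⟩ := hp
  refine ⟨l1.filter (b < ·), l2.filter (b < ·), ?_, by simp, ?_⟩
  · simp [List.filter_cons, hv]
  · rw [List.count_filter (by simpa using hv)]

theorem pos_filter_lt {b : ℕ} {h : List ℕ} {v c q r : ℕ} (hp : IsPos h v c q) (hv : b < v)
    (hr : q < r) :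
    ((h.take q).filter (b < ·)).length < ((h.take r).filter (b < ·)).length := by
  obtain ⟨⟨s, hs⟩, -⟩ := hp.take hr
  rw [hs]
  simp [List.filter_append, List.filter_cons, hv]

theorem exists_isPos {h : List ℕ} {p : ℕ} (hp : p < h.length) : ∃ c, IsPos h (h.getD p 0) c p :=
  ⟨_, isPos_iff.2 ⟨hp, rfl, rfl⟩⟩

theorem inv_of_filter {b : ℕ} {hA hB : List ℕ} (hp : hA.Perm hB)
    (hf : hA.filter (b < ·) = hB.filter (b < ·)) {p q : ℕ} (hi : IsInv hA hB p q) :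
    min (hA.getD p 0) (hA.getD q 0) ≤ b := by
  obtain ⟨h1, h2, h3⟩ := hi
  by_contra hcon
  rw [not_le, lt_min_iff] at hcon
  obtain ⟨c, hc⟩ := exists_isPos (h := hA) (p := p) (by omega)
  obtain ⟨d, hd⟩ := exists_isPos h2
  have hc' := match_spec hp hc
  have hd' := match_spec hp hd
  have e1 := pos_filter hc hcon.1
  have e2 := pos_filter hd hcon.2
  rw [hf] at e1 e2
  have e3 := e1.unique (pos_filter hc' hcon.1)
  have e4 := e2.unique (pos_filter hd' hcon.2)
  have l1 := pos_filter_lt hc hcon.1 h1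
  have l2 := pos_filter_lt hd' hcon.2 h3
  omega

theorem first_diff {l l' : List ℕ} (hl : l.length = l'.length) (hne : l ≠ l') :
    ∃ P x S y T, l = P ++ x :: S ∧ l' = P ++ y :: T ∧ x ≠ y := by
  induction l generalizing l' with
  | nil =>
    cases l' with
    | nil => exact absurd rfl hne
    | cons => simp at hl
  | cons x l ih =>
    cases l' with
    | nil => simp at hl
    | cons y l' =>
      by_cases e : x = y
      · subst e
        obtain ⟨P, a, S, c, T, h1, h2, h3⟩ := ih (l' := l') (by simpa using hl)
          (fun e => hne (by rw [e]))
        exact ⟨x :: P, a, S, c, T, by simp [h1], by simp [h2], h3⟩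
      · exact ⟨[], x, l, y, l', rfl, rfl, e⟩

theorem filter_split {b : ℕ} {h P S : List ℕ} {x : ℕ} (e : h.filter (b < ·) = P ++ x :: S) :
    ∃ l1 l2, h = l1 ++ x :: l2 ∧ l1.filter (b < ·) = P ∧ b < x := by
  obtain ⟨a1, a2, rfl, h1, h2⟩ := List.filter_eq_append_iff.1 e
  obtain ⟨u, w, rfl, h3, h4, h5⟩ := List.filter_eq_cons_iff.1 h2
  refine ⟨a1 ++ u, w, by simp, ?_, by simpa using h4⟩
  rw [List.filter_append, h1, List.filter_eq_nil_iff.2 h3, List.append_nil]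

theorem filter_of_inv {b : ℕ} {hA hB : List ℕ} (hp : hA.Perm hB)
    (hi : ∀ p q, IsInv hA hB p q → min (hA.getD p 0) (hA.getD q 0) ≤ b) :
    hA.filter (b < ·) = hB.filter (b < ·) := by
  by_contra hne
  obtain ⟨P, x, S, y, T, e1, e2, hxy⟩ := first_diff (hp.filter _).length_eq hne
  obtain ⟨A1, A2, hA', hA1, hx⟩ := filter_split e1
  obtain ⟨B1, B2, hB', hB1, hy⟩ := filter_split e2
  have cnt : ∀ (l : List ℕ) (z : ℕ), b < z → (l.filter (b < ·)).count z = l.count z :=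
    fun l z hz => List.count_filter (by simpa using hz)
  have pA : IsPos hA x (P.count x + 1) A1.length :=
    ⟨A1, A2, hA', rfl, by rw [← hA1, cnt _ _ hx]⟩
  have pB : IsPos hB y (P.count y + 1) B1.length :=
    ⟨B1, B2, hB', rfl, by rw [← hB1, cnt _ _ hy]⟩
  obtain ⟨q, hq⟩ : ∃ q, IsPos hA y (P.count y + 1) q := by
    refine exists_pos (by omega) ?_
    rw [hp.count_eq]
    rw [← hB1, cnt _ _ hy, hB']
    simp
  have hpq : A1.length < q := by
    refine lt_of_le_of_ne (hq.le_of_count ?_) ?_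
    · rw [hA', List.take_left' rfl, ← hA1, cnt _ _ hy]
      omega
    · intro e
      rw [← e] at hq
      exact hxy (pA.val hq)
  have mq : matchIdx hA hB q = B1.length := (match_spec hp hq).unique pB
  have mp := match_spec hp pA
  have hlt : B1.length < matchIdx hA hB A1.length := by
    refine lt_of_le_of_ne (mp.le_of_count ?_) ?_
    · rw [hB', List.take_left' rfl, ← hB1, cnt _ _ hx]
      omega
    · intro e
      rw [← e] at mp
      exact hxy (mp.val pB)
  have := hi A1.length q ⟨hpq, (isPos_iff.1 hq).1, by rw [mq]; exact hlt⟩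
  rw [(isPos_iff.1 hq).2.1, (isPos_iff.1 pA).2.1] at this
  rcases min_le_iff.1 this with h | h <;> omega

theorem reconf_of_rch {n : ℕ} {A B : Finset (Fin n)}
    (h : Relation.ReflTransGen (adjCJ (SimpleGraph.pathGraph n)) A B) :
    Reconf (SimpleGraph.pathGraph n) (ccMultiset (SimpleGraph.pathGraph n) A)
      (adjCJ (SimpleGraph.pathGraph n)) A B := by
  induction h with
  | refl => exact ⟨0, fun _ => A, rfl, rfl, fun _ _ => rfl, fun i hi => by omega⟩
  | @tail U V _ huv ih =>
    obtain ⟨ℓ, W, h0, hl, hm, hR⟩ := ih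
    refine ⟨ℓ + 1, fun i => if i ≤ ℓ then W i else V, by simp [h0], by simp, ?_, ?_⟩
    · intro i hi
      by_cases hil : i ≤ ℓ
      · simp only [hil, if_true]; exact hm i hil
      · simp only [hil, if_false]
        rw [← huv.1, ← hl]
        exact hm ℓ le_rfl
    · intro i hi
      by_cases hil : i < ℓ
      · have h1 : i ≤ ℓ := by omega
        have h2 : i + 1 ≤ ℓ := by omega
        simp only [h1, h2, if_true]
        exact hR i hil
      · have h1 : i = ℓ := by omega
        subst h1
        simp [hl, huv]

theorem wsum_eq (L : List (ℕ × ℕ)) : wsum L = (L.map Prod.snd).sum + L.length := by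
  induction L with
  | nil => rfl
  | cons c L ih => rw [wsum_cons, ih]; simp; omega

/-- On a path with `n` vertices, `A` and `B` with `m(A) = m(B)` and `k`
components each are reconfigurable under CJ iff every inversion `(x_i, y_j)` between
`h'_A` and `h'_B` satisfies `min {x, y} ≤ b(A, k) = n - |A| - k`. -/
theorem stmt5 (n k : ℕ) (A B : Finset (Fin n))
    (hm : ccMultiset (SimpleGraph.pathGraph n) A = ccMultiset (SimpleGraph.pathGraph n) B)
    (hkA : (comps (SimpleGraph.pathGraph n) A).card = k)
    (hkB : (comps (SimpleGraph.pathGraph n) B).card = k) :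
    Reconf (SimpleGraph.pathGraph n) (ccMultiset (SimpleGraph.pathGraph n) A)
      (adjCJ (SimpleGraph.pathGraph n)) A B ↔
    ∀ p q, IsInv (hseq n A) (hseq n B) p q →
      min ((hseq n A).getD p 0) ((hseq n A).getD q 0) ≤ n - A.card - k := by
  obtain ⟨L, hL, rfl⟩ := exists_list A
  obtain ⟨M, hM, rfl⟩ := exists_list B
  rw [card_comps hL] at hkA
  rw [hseq_toSt hL, hseq_toSt hM, card_toSt hL, cc_toSt hL]
  have hperm : (L.map Prod.snd).Perm (M.map Prod.snd) := by
    rw [cc_toSt hL, cc_toSt hM, Multiset.coe_eq_coe] at hm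
    exact hm
  have hw := wsum_eq L
  rw [hkA] at hw
  constructor
  · rintro ⟨ℓ, W, h0, hl, hcc, hR⟩
    intro p q hpq
    refine inv_of_filter hperm ?_ hpq
    have key : ∀ i, i ≤ ℓ → ∀ K, PValid 0 K (n + 1) → W i = toSt n K →
        (L.map Prod.snd).filter (n - (L.map Prod.snd).sum - k < ·)
          = (K.map Prod.snd).filter (n - (L.map Prod.snd).sum - k < ·) := by
      intro i
      induction i with
      | zero =>
        intro _ K hK e
        have := hseq_toSt hK
        rw [← e, h0, hseq_toSt hL] at this
        rw [this]
      | succ i ih =>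
        intro hi K hK e
        obtain ⟨N, hN, eN⟩ := exists_list (W i)
        rw [ih (by omega) N hN eN]
        have ha := hR i (by omega)
        rw [eN, e] at ha
        refine adj_filter hN hK ha ?_
        have hc := hcc i (by omega)
        rw [eN, cc_toSt hN, Multiset.coe_eq_coe] at hc
        rw [wsum_perm hc]
        intro z hz
        omega
    exact key ℓ le_rfl M hM hl
  · intro hi
    have hf := filter_of_inv hperm hi
    have hsw := Sw.of_filter hperm hf
    have hmap : ((L.map Prod.snd).map (· + 1)).sum = wsum L := by
      simp [wsum, Function.comp_def]
    have hpos : ∀ z ∈ L.map Prod.snd, 1 ≤ z := by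
      intro z hz
      obtain ⟨c, hc, rfl⟩ := List.mem_map.1 hz
      exact (hL.mem hc).2.1
    have hr := hsw.reach (n := n) [] (by simpa using hpos) (by
      intro z h1 h2
      rw [List.nil_append, hmap]
      omega)
    have r1 := pack_reach (P := []) (a := 0) (by simp [PValid]) hL
    have r2 := pack_reach (P := []) (a := 0) (by simp [PValid]) hM
    have := reconf_of_rch (r1.trans (Relation.ReflTransGen.trans hr (rch_symm r2)))
    rw [List.nil_append, cc_toSt hL] at this
    exact this
end

section
/- Let G be a connected cograph (a connected P4-free graph) and let X, Y ⊆ V(G) be connected vertex subsets with |X| = |Y|. Then the shortest distance d_CS1(X, Y) between X and Y under the rule CS1 equals |X \ Y| if X touches Y (i.e., X ∪ Y induces a connected subgraph), and equals |X \ Y| + 1 if X does not touch Y. -/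
open scoped Classical

/-- `G` is P4-free (a cograph): it contains no induced path on four vertices. -/
def P4Free {V : Type*} (G : SimpleGraph V) : Prop :=
  ¬ ∃ a b c d : V, a ≠ b ∧ a ≠ c ∧ a ≠ d ∧ b ≠ c ∧ b ≠ d ∧ c ≠ d ∧
    G.Adj a b ∧ G.Adj b c ∧ G.Adj c d ∧ ¬ G.Adj a c ∧ ¬ G.Adj a d ∧ ¬ G.Adj b d

/-- `X` touches `Y`: `X ∪ Y` induces a connected subgraph. -/
def Touches {V : Type*} [DecidableEq V] (G : SimpleGraph V) (X Y : Finset V) : Prop :=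
  IsConnSub G (X ∪ Y)

/-- Adjacency under CS between two single connected vertex subsets of equal size:
they differ and their union induces a connected subgraph. -/
def adjCSconn {V : Type*} [DecidableEq V] (G : SimpleGraph V) (U U' : Finset V) : Prop :=
  U ≠ U' ∧ IsConnSub G (U ∪ U')

/-- Adjacency under CS1 between two single connected vertex subsets of equal size:
CS-adjacent and they exchange exactly one vertex. -/
def adjCS1conn {V : Type*} [DecidableEq V] (G : SimpleGraph V) (U U' : Finset V) : Prop :=
  adjCSconn G U U' ∧ (U \ U').card = 1 ∧ (U' \ U).card = 1

/-- The set of lengths of reconfiguration sequences of connected vertex subsets of size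
`|X|` from `X` to `Y` with consecutive subsets adjacent under `R`; its infimum is the
shortest distance `d_R(X, Y)`. -/
def connSeqLengths {V : Type*} (G : SimpleGraph V) (R : Finset V → Finset V → Prop)
    (X Y : Finset V) : Set ℕ :=
  {ℓ | ∃ W : ℕ → Finset V, W 0 = X ∧ W ℓ = Y ∧
    (∀ i ≤ ℓ, IsConnSub G (W i) ∧ (W i).card = X.card) ∧
    ∀ i < ℓ, R (W i) (W (i + 1))}

/-- Cut version of connectedness. -/
def CC {V : Type*} (G : SimpleGraph V) (U : Finset V) : Prop :=
  U.Nonempty ∧ ∀ T : Finset V, T ⊆ U → T.Nonempty → (∃ z ∈ U, z ∉ T) →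
    ∃ a ∈ T, ∃ b ∈ U, b ∉ T ∧ G.Adj a b

theorem cc_iff {V : Type*} (G : SimpleGraph V) (U : Finset V) :
    IsConnSub G U ↔ CC G U := by
  constructor
  · intro h
    refine ⟨?_, ?_⟩
    · obtain ⟨⟨x, hx⟩⟩ := h.nonempty
      exact ⟨x, by simpa using hx⟩
    · rintro T hT ⟨t, ht⟩ ⟨z, hzU, hzT⟩
      obtain ⟨p⟩ := h.preconnected ⟨t, by simpa using hT ht⟩ ⟨z, by simpa using hzU⟩
      obtain ⟨d, -, h1, h2⟩ := p.exists_boundary_dart {v | v.1 ∈ T} ht hzT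
      refine ⟨d.fst.1, h1, d.snd.1, by simpa using d.snd.2, h2, ?_⟩
      simpa using d.adj
  · rintro ⟨⟨u, hu⟩, h⟩
    unfold IsConnSub
    rw [SimpleGraph.connected_iff_exists_forall_reachable]
    refine ⟨⟨u, by simpa using hu⟩, ?_⟩
    by_contra hc
    push Not at hc
    obtain ⟨⟨w, hw⟩, hwr⟩ := hc
    have hw' : w ∈ U := by simpa using hw
    let T : Finset V := U.filter (fun v => ∃ hv : v ∈ (U : Set V),
      (G.induce (U : Set V)).Reachable ⟨u, by simpa using hu⟩ ⟨v, hv⟩)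
    obtain ⟨a, ha, b, hb, hbT, hab⟩ := h T (Finset.filter_subset _ _)
      ⟨u, by
        simp only [T, Finset.mem_filter]
        exact ⟨hu, by simpa using hu, SimpleGraph.Reachable.refl _⟩⟩
      ⟨w, hw', by
        simp only [T, Finset.mem_filter]
        rintro ⟨_, hv, hr⟩
        exact hwr hr⟩
    simp only [T, Finset.mem_filter] at ha hbT
    obtain ⟨haU, hv, hr⟩ := ha
    apply hbT
    have hb' : b ∈ (U : Set V) := by simpa using hb
    refine ⟨hb, hb', hr.trans (SimpleGraph.Adj.reachable ?_)⟩
    simpa using hab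

theorem cc_union {V : Type*} [DecidableEq V] {G : SimpleGraph V} {U U' : Finset V} {c : V}
    (h : CC G U) (h' : CC G U') (hc : c ∈ U) (hc' : c ∈ U') : CC G (U ∪ U') := by
  refine ⟨⟨c, by simp [hc]⟩, ?_⟩
  have key : ∀ (W : Finset V), CC G W → W ⊆ U ∪ U' → ∀ T : Finset V, ∀ x ∈ W, x ∈ T →
      ∀ y ∈ W, y ∉ T → ∃ a ∈ T, ∃ b ∈ U ∪ U', b ∉ T ∧ G.Adj a b := by
    intro W hW hWs T x hx hxT y hy hyT
    obtain ⟨a, ha, b, hb, hbT, hab⟩ := hW.2 (W ∩ T) Finset.inter_subset_left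
      ⟨x, by simp [hx, hxT]⟩ ⟨y, hy, by simp [hyT]⟩
    refine ⟨a, (Finset.mem_inter.1 ha).2, b, hWs hb, ?_, hab⟩
    intro h; exact hbT (Finset.mem_inter.2 ⟨hb, h⟩)
  rintro T hT ⟨t, ht⟩ ⟨z, hz, hzT⟩
  have k1 := key U h Finset.subset_union_left T
  have k2 := key U' h' Finset.subset_union_right T
  have htU := hT ht
  rw [Finset.mem_union] at htU hz
  by_cases hcT : c ∈ T
  · rcases hz with hz | hz
    · exact k1 c hc hcT z hz hzT
    · exact k2 c hc' hcT z hz hzT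
  · rcases htU with hz | hz
    · exact k1 t hz ht c hc hcT
    · exact k2 t hz ht c hc' hcT

theorem cc_star {V : Type*} {G : SimpleGraph V} {U : Finset V} {c : V}
    (hc : c ∈ U) (h : ∀ u ∈ U, u ≠ c → G.Adj c u) : CC G U := by
  refine ⟨⟨c, hc⟩, ?_⟩
  rintro T hT ⟨t, ht⟩ ⟨z, hz, hzT⟩
  by_cases hcT : c ∈ T
  · exact ⟨c, hcT, z, hz, hzT, h z hz (by rintro rfl; exact hzT hcT)⟩
  · exact ⟨t, ht, c, hc, hcT, (h t (hT ht) (by rintro rfl; exact hcT ht)).symm⟩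

theorem cc_join {V : Type*} {G : SimpleGraph V} {U : Finset V} {A B : Finset V}
    (hAB : ∀ a ∈ A, ∀ b ∈ B, G.Adj a b) (hU : ∀ u ∈ U, u ∈ A ∨ u ∈ B)
    {a b : V} (ha : a ∈ U) (haA : a ∈ A) (hb : b ∈ U) (hbB : b ∈ B) : CC G U := by
  refine ⟨⟨a, ha⟩, ?_⟩
  rintro T hT ⟨t, ht⟩ ⟨z, hz, hzT⟩
  have hBA : ∀ b ∈ B, ∀ a ∈ A, G.Adj b a := fun b hb a ha => (hAB a ha b hb).symm
  rcases hU t (hT ht) with h1 | h1 <;> rcases hU z hz with h2 | h2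
  · by_cases hbT : b ∈ T
    · exact ⟨b, hbT, z, hz, hzT, hBA _ hbB _ h2⟩
    · exact ⟨t, ht, b, hb, hbT, hAB _ h1 _ hbB⟩
  · exact ⟨t, ht, z, hz, hzT, hAB _ h1 _ h2⟩
  · exact ⟨t, ht, z, hz, hzT, hBA _ h1 _ h2⟩
  · by_cases haT : a ∈ T
    · exact ⟨a, haT, z, hz, hzT, hAB _ haA _ h2⟩
    · exact ⟨t, ht, a, ha, haT, hBA _ h1 _ haA⟩

theorem p4_compl {V : Type*} {G : SimpleGraph V} (h : P4Free G) : P4Free Gᶜ := by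
  rintro ⟨a, b, c, d, h1, h2, h3, h4, h5, h6, e1, e2, e3, n1, n2, n3⟩
  simp only [SimpleGraph.compl_adj, not_and, not_not] at e1 e2 e3 n1 n2 n3
  exact h ⟨b, d, a, c, h5, h1.symm, h4, h3.symm, h6.symm, h2, n3 h5, (n2 h3).symm, n1 h2,
    fun h => e1.2 h.symm, e2.2, fun h => e3.2 h.symm⟩

theorem p4_step {V : Type*} [DecidableEq V] {H : SimpleGraph V} (hP : P4Free H) (S : Finset V)
    (v : V) (hv : v ∈ S) (h1 : CC H S) (h2 : CC Hᶜ S) (hne : (S.erase v).Nonempty)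
    (h3 : ¬ CC H (S.erase v)) : False := by
  obtain ⟨z, hz⟩ := hne
  obtain ⟨v', hv', w, hwS, hwv, hvw⟩ := h2.2 {v} (by simpa using hv) ⟨v, by simp⟩
    ⟨z, (Finset.mem_erase.1 hz).2, by simpa using (Finset.mem_erase.1 hz).1⟩
  rw [Finset.mem_singleton] at hv' hwv
  subst v'
  have hvw : ¬ H.Adj v w := (SimpleGraph.compl_adj _ _ _ |>.1 hvw).2
  let P : Finset V → Prop := fun C => C ⊆ S.erase v ∧ w ∈ C ∧
    ∀ a ∈ C, ∀ b ∈ S.erase v, b ∉ C → ¬ H.Adj a b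
  have hex : ∃ C, P C ∧ ∃ r ∈ S.erase v, r ∉ C := by
    unfold CC at h3
    push Not at h3
    obtain ⟨T, hT, ⟨t, ht⟩, ⟨y, hy, hyT⟩, hcl⟩ := h3 ⟨z, hz⟩
    by_cases hwT : w ∈ T
    · exact ⟨T, ⟨hT, hwT, hcl⟩, y, hy, hyT⟩
    · refine ⟨S.erase v \ T, ⟨Finset.sdiff_subset, ?_, ?_⟩, t, hT ht, ?_⟩
      · simp [hwS, hwv, hwT]
      · intro a ha b hb hbT hab
        rw [Finset.mem_sdiff] at ha hbT
        have : b ∈ T := by by_contra h; exact hbT ⟨hb, h⟩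
        exact hcl b this a ha.1 ha.2 hab.symm
      · simp [ht]
  have hex' : ∃ n, ∃ C, P C ∧ (∃ r ∈ S.erase v, r ∉ C) ∧ C.card = n := by
    obtain ⟨C, h, h'⟩ := hex
    exact ⟨_, C, h, h', rfl⟩
  obtain ⟨C, ⟨hCs, hwC, hcl⟩, ⟨r0, hr0, hr0C⟩, hcard⟩ := Nat.find_spec hex'
  have hmin : ∀ D, P D → (∃ r ∈ S.erase v, r ∉ D) → C.card ≤ D.card := by
    intro D hD hD'
    rw [hcard]
    exact Nat.find_min' hex' ⟨D, hD, hD', rfl⟩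
  -- neighbour of v in C
  have hCS : C ⊆ S := hCs.trans (Finset.erase_subset _ _)
  have hvC : v ∉ C := fun h => by simpa using hCs h
  have hp0 : ∃ p ∈ C, H.Adj p v := by
    obtain ⟨a, ha, b, hb, hbC, hab⟩ := h1.2 C hCS ⟨w, hwC⟩ ⟨v, hv, hvC⟩
    by_cases hbv : b = v
    · subst hbv; exact ⟨a, ha, hab⟩
    · exact absurd hab (hcl a ha b (by simp [hb, hbv]) hbC)
  have hr : ∃ r ∈ S.erase v, r ∉ C ∧ H.Adj v r := by
    obtain ⟨a, ha, b, hb, hbC, hab⟩ := h1.2 (insert v C)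
      (Finset.insert_subset hv hCS) ⟨v, by simp⟩
      ⟨r0, (Finset.mem_erase.1 hr0).2, by simp [(Finset.mem_erase.1 hr0).1, hr0C]⟩
    rw [Finset.mem_insert, not_or] at hbC
    have hb' : b ∈ S.erase v := by simp [hb, hbC.1]
    rcases Finset.mem_insert.1 ha with rfl | ha
    · exact ⟨b, hb', hbC.2, hab⟩
    · exact absurd hab (hcl a ha b hb' hbC.2)
  have hqp : ∃ q ∈ C, ¬ H.Adj v q ∧ ∃ p ∈ C, H.Adj v p ∧ H.Adj q p := by
    by_contra hno
    push Not at hno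
    obtain ⟨p0, hp0, hp0v⟩ := hp0
    have hlt : (C.filter (fun q => ¬ H.Adj v q)).card < C.card := by
      apply Finset.card_lt_card
      rw [Finset.filter_ssubset]
      exact ⟨p0, hp0, not_not.2 hp0v.symm⟩
    have := hmin (C.filter (fun q => ¬ H.Adj v q)) ⟨(Finset.filter_subset _ _).trans hCs,
      by simp [hwC, hvw], by
        intro a ha b hb hbD hab
        rw [Finset.mem_filter] at ha hbD
        by_cases hbC : b ∈ C
        · have : H.Adj v b := by by_contra h; exact hbD ⟨hbC, h⟩
          exact hno a ha.1 ha.2 b hbC this hab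
        · exact hcl a ha.1 b hb hbC hab⟩
      ⟨r0, hr0, by simp [hr0C]⟩
    omega
  obtain ⟨r, hrS, hrC, hvr⟩ := hr
  obtain ⟨q, hq, hvq, p, hp, hvp, hqp⟩ := hqp
  refine hP ⟨q, p, v, r, hqp.ne, ?_, ?_, hvp.ne.symm, ?_, hvr.ne, hqp, hvp.symm, hvr,
    fun h => hvq h.symm, hcl q hq r hrS hrC, hcl p hp r hrS hrC⟩
  · rintro rfl; exact hvC hq
  · rintro rfl; exact hrC hq
  · rintro rfl; exact hrC hp

theorem p4_main {V : Type*} [DecidableEq V] {G : SimpleGraph V} (hP : P4Free G) :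
    ∀ (n : ℕ) (S : Finset V), S.card = n → 2 ≤ n → CC G S → CC Gᶜ S → False := by
  intro n
  induction n with
  | zero => intro S _ h; omega
  | succ n ih =>
    intro S hS hn h1 h2
    obtain ⟨v, hv⟩ := h1.1
    have hc : (S.erase v).card = n := by rw [Finset.card_erase_of_mem hv]; omega
    have hne : (S.erase v).Nonempty := by rw [← Finset.card_pos]; omega
    by_cases h3 : CC G (S.erase v)
    · by_cases h4 : CC Gᶜ (S.erase v)
      · by_cases hn2 : 2 ≤ n
        · exact ih _ hc hn2 h3 h4
        · have hn1 : n = 1 := by omega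
          subst hn1
          obtain ⟨u, hu⟩ := Finset.card_eq_one.1 hc
          have huS : u ∈ S.erase v := by rw [hu]; simp
          have hex : ∃ z ∈ S, z ∉ ({v} : Finset V) :=
            ⟨u, (Finset.mem_erase.1 huS).2, by simpa using (Finset.mem_erase.1 huS).1⟩
          obtain ⟨a, ha, b, hb, hbn, hab⟩ := h1.2 {v} (by simpa using hv) ⟨v, by simp⟩ hex
          obtain ⟨a', ha', b', hb', hbn', hab'⟩ := h2.2 {v} (by simpa using hv) ⟨v, by simp⟩ hex
          rw [Finset.mem_singleton] at ha ha' hbn hbn'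
          have e1 : b ∈ S.erase v := by simp [hb, hbn]
          have e2 : b' ∈ S.erase v := by simp [hb', hbn']
          rw [hu, Finset.mem_singleton] at e1 e2
          subst a a' b b'
          exact (SimpleGraph.compl_adj _ _ _ |>.1 hab').2 hab
      · exact p4_step (p4_compl hP) S v hv h2 (by rwa [compl_compl]) hne h4
    · exact p4_step hP S v hv h1 h2 hne h3

theorem join_decomp {V : Type*} [DecidableEq V] {G : SimpleGraph V} (hP : P4Free G) (S : Finset V)
    (h2 : 2 ≤ S.card) (hS : CC G S) : ∃ A B : Finset V, A.Nonempty ∧ B.Nonempty ∧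
      (∀ u, u ∈ S ↔ u ∈ A ∨ u ∈ B) ∧ (∀ a ∈ A, ∀ b ∈ B, G.Adj a b) := by
  have h := fun h => p4_main hP _ S rfl h2 hS h
  unfold CC at h
  simp only [imp_false, not_and] at h
  have h := h hS.1
  push Not at h
  obtain ⟨T, hT, hTn, ⟨z, hz, hzT⟩, hcl⟩ := h
  refine ⟨T, S \ T, hTn, ⟨z, by simp [hz, hzT]⟩, ?_, ?_⟩
  · intro u
    rw [Finset.mem_sdiff]
    have := @hT u
    tauto
  · intro a ha b hb
    rw [Finset.mem_sdiff] at hb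
    by_contra hab
    refine hcl a ha b hb.1 hb.2 ((SimpleGraph.compl_adj _ _ _).2 ⟨?_, hab⟩)
    rintro rfl; exact hb.2 ha

/-- One step in the touching case, with good pair. -/
theorem touch_step {V : Type*} [DecidableEq V] {G : SimpleGraph V} (hP : P4Free G)
    (X Y : Finset V) (hX : CC G X) (hY : CC G Y) (hXY : CC G (X ∪ Y))
    (hcard : X.card = Y.card) (hne : X ≠ Y) :
    ∃ x ∈ X, x ∉ Y ∧ ∃ y ∈ Y, y ∉ X ∧ CC G (insert y X) ∧ CC G (insert y (X.erase x)) := by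
  have hx0 : ∃ x ∈ X, x ∉ Y := by
    by_contra h
    push Not at h
    exact hne (Finset.eq_of_subset_of_card_le h hcard.ge)
  have hy0 : ∃ y ∈ Y, y ∉ X := by
    by_contra h
    push Not at h
    exact hne (Finset.eq_of_subset_of_card_le h hcard.le).symm
  obtain ⟨x0, hx0, hx0Y⟩ := hx0
  obtain ⟨y0, hy0, hy0X⟩ := hy0
  have h2 : 2 ≤ (X ∪ Y).card := by
    have : ({x0, y0} : Finset V) ⊆ X ∪ Y := by
      intro z; simp only [Finset.mem_insert, Finset.mem_singleton, Finset.mem_union]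
      rintro (rfl | rfl) <;> tauto
    have h := Finset.card_le_card this
    rwa [Finset.card_pair (by rintro rfl; exact hy0X hx0)] at h
  obtain ⟨A, B, hA, hB, hS, hAB⟩ := join_decomp hP _ h2 hXY
  have hXs : ∀ u ∈ X, u ∈ A ∨ u ∈ B := fun u hu => (hS u).1 (by simp [hu])
  have hYs : ∀ u ∈ Y, u ∈ A ∨ u ∈ B := fun u hu => (hS u).1 (by simp [hu])
  -- X on one side
  have caseX : ∀ A B : Finset V, (∀ a ∈ A, ∀ b ∈ B, G.Adj a b) → B.Nonempty →
      (∀ u, u ∈ X ∪ Y ↔ u ∈ A ∨ u ∈ B) → (∀ u ∈ X, u ∉ B) →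
      ∃ x ∈ X, x ∉ Y ∧ ∃ y ∈ Y, y ∉ X ∧ CC G (insert y X) ∧ CC G (insert y (X.erase x)) := by
    intro A B hAB ⟨b, hb⟩ hS hXB
    have hbX : b ∉ X := fun h => hXB b h hb
    have hbY : b ∈ Y := by
      have := (hS b).2 (Or.inr hb)
      rw [Finset.mem_union] at this; tauto
    have hXA : ∀ u ∈ X, G.Adj b u := fun u hu => by
      have := (hS u).1 (by simp [hu])
      have h := hXB u hu
      exact (hAB u (by tauto) b hb).symm
    refine ⟨x0, hx0, hx0Y, b, hbY, hbX, cc_star (c := b) (by simp) ?_,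
      cc_star (c := b) (by simp) ?_⟩
    · intro u hu hub
      exact hXA u (by simpa [hub] using hu)
    · intro u hu hub
      have : u ≠ x0 ∧ u ∈ X := by simpa [hub] using hu
      exact hXA u this.2
  by_cases hXB : ∀ u ∈ X, u ∉ B
  · exact caseX A B hAB hB hS hXB
  by_cases hXA : ∀ u ∈ X, u ∉ A
  · exact caseX B A (fun b hb a ha => (hAB a ha b hb).symm) hA (fun u => (hS u).trans or_comm) hXA
  push Not at hXA hXB
  obtain ⟨a, haX, haA⟩ := hXA
  obtain ⟨b, hbX, hbB⟩ := hXB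
  have hins : ∀ y ∈ Y, CC G (insert y X) := by
    intro y hy
    refine cc_join hAB ?_ (a := a) (b := b) (by simp [haX]) haA (by simp [hbX]) hbB
    intro u hu
    rcases Finset.mem_insert.1 hu with rfl | hu
    · exact hYs _ hy
    · exact hXs _ hu
  -- enough to have both sides hit
  have fin : ∀ x ∈ X, x ∉ Y → ∀ y ∈ Y, y ∉ X →
      (∃ a' ∈ A, a' = y ∨ (a' ∈ X ∧ a' ≠ x)) → (∃ b' ∈ B, b' = y ∨ (b' ∈ X ∧ b' ≠ x)) →
      ∃ x ∈ X, x ∉ Y ∧ ∃ y ∈ Y, y ∉ X ∧ CC G (insert y X) ∧ CC G (insert y (X.erase x)) := by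
    rintro x hx hxY y hy hyX ⟨a', ha', ha''⟩ ⟨b', hb', hb''⟩
    refine ⟨x, hx, hxY, y, hy, hyX, hins y hy,
      cc_join hAB ?_ (a := a') (b := b') (by simp; tauto) ha' (by simp; tauto) hb'⟩
    intro u hu
    rcases Finset.mem_insert.1 hu with rfl | hu
    · exact hYs _ hy
    · exact hXs _ (Finset.mem_of_mem_erase hu)
  -- unique difference: result is Y
  by_cases hone : ∀ x ∈ X, x ∉ Y → x = x0
  · refine ⟨x0, hx0, hx0Y, y0, hy0, hy0X, hins y0 hy0, ?_⟩
    have : insert y0 (X.erase x0) = Y := by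
      apply Finset.eq_of_subset_of_card_le
      · intro u hu
        rcases Finset.mem_insert.1 hu with rfl | hu
        · exact hy0
        · rw [Finset.mem_erase] at hu
          by_contra h
          exact hu.1 (hone u hu.2 h)
      · rw [Finset.card_insert_of_notMem (by simp [hy0X]), Finset.card_erase_of_mem hx0]
        omega
    rwa [this]
  push Not at hone
  obtain ⟨x1, hx1, hx1Y, hx10⟩ := hone
  -- disjointness of A and B
  have hdis : ∀ u ∈ A, u ∉ B := fun u h1 h2 => G.irrefl (hAB u h1 u h2)
  by_cases hYB : ∀ u ∈ Y, u ∉ B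
  · have hy0A : y0 ∈ A := by have := hYs y0 hy0; have := hYB y0 hy0; tauto
    by_cases hbx : b = x0
    · exact fin x1 hx1 hx1Y y0 hy0 hy0X ⟨y0, hy0A, Or.inl rfl⟩
        ⟨b, hbB, Or.inr ⟨hbX, by rw [hbx]; exact hx10.symm⟩⟩
    · exact fin x0 hx0 hx0Y y0 hy0 hy0X ⟨y0, hy0A, Or.inl rfl⟩
        ⟨b, hbB, Or.inr ⟨hbX, hbx⟩⟩
  by_cases hYA : ∀ u ∈ Y, u ∉ A
  · have hy0B : y0 ∈ B := by have := hYs y0 hy0; have := hYA y0 hy0; tauto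
    by_cases hax : a = x0
    · exact fin x1 hx1 hx1Y y0 hy0 hy0X 
        ⟨a, haA, Or.inr ⟨haX, by rw [hax]; exact hx10.symm⟩⟩ ⟨y0, hy0B, Or.inl rfl⟩
    · exact fin x0 hx0 hx0Y y0 hy0 hy0X 
        ⟨a, haA, Or.inr ⟨haX, hax⟩⟩ ⟨y0, hy0B, Or.inl rfl⟩
  push Not at hYA hYB
  obtain ⟨a2, ha2Y, ha2A⟩ := hYA
  obtain ⟨b2, hb2Y, hb2B⟩ := hYB
  rcases hXs x0 hx0 with hxs | hxs
  · have hb' : b ≠ x0 := by rintro rfl; exact hdis _ hxs hbB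
    by_cases ha2X : a2 ∈ X
    · exact fin x0 hx0 hx0Y y0 hy0 hy0X
        ⟨a2, ha2A, Or.inr ⟨ha2X, by rintro rfl; exact hx0Y ha2Y⟩⟩ ⟨b, hbB, Or.inr ⟨hbX, hb'⟩⟩
    · exact fin x0 hx0 hx0Y a2 ha2Y ha2X ⟨a2, ha2A, Or.inl rfl⟩ ⟨b, hbB, Or.inr ⟨hbX, hb'⟩⟩
  · have ha' : a ≠ x0 := by rintro rfl; exact hdis _ haA hxs
    by_cases hb2X : b2 ∈ X
    · exact fin x0 hx0 hx0Y y0 hy0 hy0X ⟨a, haA, Or.inr ⟨haX, ha'⟩⟩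
        ⟨b2, hb2B, Or.inr ⟨hb2X, by rintro rfl; exact hx0Y hb2Y⟩⟩
    · exact fin x0 hx0 hx0Y b2 hb2Y hb2X ⟨a, haA, Or.inr ⟨haX, ha'⟩⟩ ⟨b2, hb2B, Or.inl rfl⟩

theorem swap_adj {V : Type*} [DecidableEq V] {G : SimpleGraph V} {X : Finset V} {x y : V}
    (hx : x ∈ X) (hy : y ∉ X) (h : CC G (insert y X)) :
    adjCS1conn G X (insert y (X.erase x)) ∧ (insert y (X.erase x)).card = X.card := by
  have hxy : x ≠ y := by rintro rfl; exact hy hx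
  refine ⟨⟨⟨?_, ?_⟩, ?_, ?_⟩, ?_⟩
  · intro h; rw [h] at hy; simp at hy
  · rw [cc_iff]
    convert h using 1
    ext u; simp only [Finset.mem_union, Finset.mem_insert, Finset.mem_erase]; tauto
  · rw [Finset.card_eq_one]
    refine ⟨x, ?_⟩
    ext u
    simp only [Finset.mem_sdiff, Finset.mem_insert, Finset.mem_erase, Finset.mem_singleton]
    constructor
    · tauto
    · rintro rfl; tauto
  · rw [Finset.card_eq_one]
    refine ⟨y, ?_⟩
    ext u
    simp only [Finset.mem_sdiff, Finset.mem_insert, Finset.mem_erase, Finset.mem_singleton]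
    constructor
    · tauto
    · rintro rfl; tauto
  · rw [Finset.card_insert_of_notMem (by simp [hy]), Finset.card_erase_of_mem hx]
    have := Finset.card_pos.2 ⟨x, hx⟩
    omega

theorem len_succ {V : Type*} [DecidableEq V] {G : SimpleGraph V} {X X' Y : Finset V} {n : ℕ}
    (hX : CC G X) (hadj : adjCS1conn G X X') (hc : X'.card = X.card)
    (h : n ∈ connSeqLengths G (adjCS1conn G) X' Y) :
    n + 1 ∈ connSeqLengths G (adjCS1conn G) X Y := by
  obtain ⟨W, h0, h1, h2, h3⟩ := h
  refine ⟨fun i => Nat.casesOn i X W, rfl, h1, ?_, ?_⟩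
  · rintro (_ | i) hi
    · exact ⟨(cc_iff _ _).2 hX, rfl⟩
    · have := h2 i (by omega)
      exact ⟨this.1, this.2.trans hc⟩
  · rintro (_ | i) hi
    · show adjCS1conn G X (W 0)
      rwa [h0]
    · exact h3 i (by omega)

theorem touch_upper {V : Type*} [DecidableEq V] {G : SimpleGraph V} (hP : P4Free G)
    (Y : Finset V) (hY : CC G Y) : ∀ (n : ℕ) (X : Finset V), (X \ Y).card = n →
    CC G X → CC G (X ∪ Y) → X.card = Y.card →
    n ∈ connSeqLengths G (adjCS1conn G) X Y := by
  intro n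
  induction n with
  | zero =>
    intro X hn hX _ hc
    have : X = Y := Finset.eq_of_subset_of_card_le
      (Finset.sdiff_eq_empty_iff_subset.1 (Finset.card_eq_zero.1 hn)) hc.ge
    subst this
    exact ⟨fun _ => X, rfl, rfl, fun _ _ => ⟨(cc_iff _ _).2 hX, rfl⟩, fun i hi => by omega⟩
  | succ n ih =>
    intro X hn hX hXY hc
    obtain ⟨x, hx, hxY, y, hy, hyX, h1, h2⟩ := touch_step hP X Y hX hY hXY hc
      (by rintro rfl; simp at hn)
    obtain ⟨ha, hc'⟩ := swap_adj hx hyX h1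
    refine len_succ hX ha hc' (ih _ ?_ h2 (cc_union h2 hY (by simp) hy) (hc'.trans hc))
    have : insert y (X.erase x) \ Y = (X \ Y).erase x := by
      ext u
      simp only [Finset.mem_sdiff, Finset.mem_insert, Finset.mem_erase]
      constructor
      · rintro ⟨rfl | h, h'⟩ <;> tauto
      · tauto
    rw [this, Finset.card_erase_of_mem (by simp [hx, hxY])]
    omega

theorem lower {V : Type*} [DecidableEq V] {G : SimpleGraph V} (Y : Finset V) (W : ℕ → Finset V) :
    ∀ n k, W (k + n) = Y → (∀ i < k + n, adjCS1conn G (W i) (W (i + 1))) →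
      (W k \ Y).card ≤ n := by
  intro n
  induction n with
  | zero => intro k h _; simp only [add_zero] at h; simp [h]
  | succ n ih =>
    intro k h ha
    have h1 := ih (k + 1) (by rw [← h]; congr 1; omega) (fun i hi => ha i (by omega))
    have h2 := (ha k (by omega)).2.1
    have h3 : W k \ Y ⊆ (W k \ W (k + 1)) ∪ (W (k + 1) \ Y) := by
      intro u; simp only [Finset.mem_sdiff, Finset.mem_union]; tauto
    have := (Finset.card_le_card h3).trans (Finset.card_union_le _ _)
    omega

theorem nontouch_lower {V : Type*} [DecidableEq V] {G : SimpleGraph V} {X Y : Finset V}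
    (hY : CC G Y) (hX : CC G X) (hn : ¬ CC G (X ∪ Y)) {n : ℕ}
    (h : n ∈ connSeqLengths G (adjCS1conn G) X Y) : (X \ Y).card + 1 ≤ n := by
  obtain ⟨W, h0, h1, h2, h3⟩ := h
  rcases n with _ | n
  · exfalso
    apply hn
    rw [← h0, h1, Finset.union_idempotent]
    exact hY
  have hl := lower (G := G) Y W n 1 (by rw [← h1]; congr 1; omega) (fun i hi => h3 i (by omega))
  have hd : ∀ y ∈ W 1, y ∉ Y := by
    intro y hy1 hyY
    apply hn
    by_cases hyX : y ∈ X
    · exact cc_union hX hY hyX hyY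
    have ha := h3 0 (by omega)
    rw [h0, zero_add] at ha
    obtain ⟨z, hz⟩ := Finset.card_eq_one.1 ha.2.2
    have hz' : ∀ u, u ∈ W 1 → u ∉ X → u ∈ Y := by
      intro u hu huX
      have e1 : u ∈ W 1 \ X := by simp [hu, huX]
      have e2 : y ∈ W 1 \ X := by simp [hy1, hyX]
      rw [hz, Finset.mem_singleton] at e1 e2
      rwa [e1, ← e2]
    have := cc_union ((cc_iff _ _).1 ha.1.2) hY (c := y) (by simp [hy1]) hyY
    convert this using 1
    ext u
    have := hz' u
    simp only [Finset.mem_union]; tauto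
  have e : W 1 \ Y = W 1 := Finset.sdiff_eq_self_iff_disjoint.2 (Finset.disjoint_left.2 hd)
  rw [e, (h2 1 (by omega)).2] at hl
  have := Finset.card_le_card (Finset.sdiff_subset (s := X) (t := Y))
  omega

theorem nontouch_upper {V : Type*} [Fintype V] [DecidableEq V] {G : SimpleGraph V}
    (hP : P4Free G) (hG : CC G Finset.univ) {X Y : Finset V}
    (hX : CC G X) (hY : CC G Y) (hn : ¬ CC G (X ∪ Y)) (hcard : X.card = Y.card) :
    (X \ Y).card + 1 ∈ connSeqLengths G (adjCS1conn G) X Y := by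
  have hd : ∀ u ∈ X, u ∉ Y := fun u h1 h2 => hn (cc_union hX hY h1 h2)
  obtain ⟨x, hx⟩ := hX.1
  obtain ⟨y, hy⟩ := hY.1
  have h2 : 2 ≤ (Finset.univ : Finset V).card := by
    have h := Finset.card_le_card (Finset.subset_univ ({x, y} : Finset V))
    rwa [Finset.card_pair (by rintro rfl; exact hd _ hx hy)] at h
  have hnadj : ∀ u ∈ X, ∀ w ∈ Y, ¬ G.Adj u w := by
    intro u hu w hw huw
    apply hn
    have e : CC G ({u, w} : Finset V) := by
      refine cc_star (c := u) (by simp) ?_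
      intro z hz hzu
      simp only [Finset.mem_insert, Finset.mem_singleton] at hz
      rcases hz with rfl | rfl
      · exact absurd rfl hzu
      · exact huw
    have := cc_union (cc_union hX e hu (by simp)) hY (c := w) (by simp) hw
    convert this using 1
    ext z
    simp only [Finset.mem_union, Finset.mem_insert, Finset.mem_singleton]
    constructor
    · tauto
    · rintro ((h | rfl | rfl) | h) <;> tauto
  obtain ⟨A, B, hA, hB, hS, hAB⟩ := join_decomp hP _ h2 hG
  have hb : ∃ b, ∀ u, u ∈ X ∪ Y → G.Adj b u := by
    have key : ∀ A B : Finset V, B.Nonempty → (∀ a ∈ A, ∀ b ∈ B, G.Adj a b) →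
        (∀ u, u ∈ A ∨ u ∈ B) → x ∈ A → ∃ b, ∀ u, u ∈ X ∪ Y → G.Adj b u := by
      intro A B ⟨b, hb⟩ hAB hS hxA
      have hYA : ∀ w ∈ Y, w ∈ A := fun w hw => by
        rcases hS w with h | h
        · exact h
        · exact absurd (hAB x hxA w h) (hnadj x hx w hw)
      have hXA : ∀ w ∈ X, w ∈ A := fun w hw => by
        rcases hS w with h | h
        · exact h
        · exact absurd (hAB y (hYA y hy) w h).symm (hnadj w hw y hy)
      refine ⟨b, fun u hu => (hAB u ?_ b hb).symm⟩
      rcases Finset.mem_union.1 hu with h | h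
      · exact hXA u h
      · exact hYA u h
    have hS' : ∀ u, u ∈ A ∨ u ∈ B := fun u => (hS u).1 (Finset.mem_univ u)
    rcases hS' x with h | h
    · exact key A B hB hAB hS' h
    · exact key B A hA (fun b hb a ha => (hAB a ha b hb).symm) (fun u => (hS' u).symm) h
  obtain ⟨b, hb⟩ := hb
  have hbX : b ∉ X := fun h => G.irrefl (hb b (by simp [h]))
  have hbY : b ∉ Y := fun h => G.irrefl (hb b (by simp [h]))
  have star : ∀ U : Finset V, U ⊆ X ∪ Y → CC G (insert b U) := by
    intro U hU
    refine cc_star (c := b) (by simp) ?_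
    intro u hu hub
    exact hb u (hU (by simpa [hub] using hu))
  obtain ⟨ha, hc'⟩ := swap_adj hx hbX (star X Finset.subset_union_left)
  refine len_succ hX ha hc' (touch_upper hP Y hY _ _ ?_ (star _ ?_) ?_ (hc'.trans hcard))
  · rw [Finset.sdiff_eq_self_iff_disjoint.2, Finset.sdiff_eq_self_iff_disjoint.2, hc']
    · exact Finset.disjoint_left.2 hd
    · rw [Finset.disjoint_left]
      intro u hu
      rcases Finset.mem_insert.1 hu with rfl | hu
      · exact hbY
      · exact hd u (Finset.mem_of_mem_erase hu)
  · exact (Finset.erase_subset _ _).trans Finset.subset_union_left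
  · rw [Finset.insert_union]
    exact star _ (Finset.union_subset_union_left (Finset.erase_subset _ _))

/-- In a connected cograph, for connected subsets `X`, `Y` of equal size,
the CS1-distance is `|X \ Y|` if `X` touches `Y`, and `|X \ Y| + 1` otherwise. -/
theorem stmt8 {V : Type*} [Fintype V] [DecidableEq V] (G : SimpleGraph V)
    (hconn : G.Connected) (hP4 : P4Free G) (X Y : Finset V)
    (hX : IsConnSub G X) (hY : IsConnSub G Y) (hcard : X.card = Y.card) :
    (connSeqLengths G (adjCS1conn G) X Y).Nonempty ∧
    sInf (connSeqLengths G (adjCS1conn G) X Y) =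
      (if Touches G X Y then (X \ Y).card else (X \ Y).card + 1) := by
  have hX' := (cc_iff _ _).1 hX
  have hY' := (cc_iff _ _).1 hY
  have main : ∀ n, n ∈ connSeqLengths G (adjCS1conn G) X Y →
      (∀ m ∈ connSeqLengths G (adjCS1conn G) X Y, n ≤ m) →
      (connSeqLengths G (adjCS1conn G) X Y).Nonempty ∧
        sInf (connSeqLengths G (adjCS1conn G) X Y) = n := fun n hn hm =>
    ⟨⟨n, hn⟩, le_antisymm (Nat.sInf_le hn) (hm _ (Nat.sInf_mem ⟨n, hn⟩))⟩
  split_ifs with ht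
  · refine main _ (touch_upper hP4 Y hY' _ X rfl hX' ((cc_iff _ _).1 ht) hcard) ?_
    rintro m ⟨W, h0, h1, -, h3⟩
    have := lower (G := G) Y W m 0 (by simpa using h1) (by simpa using h3)
    rwa [h0] at this
  · have hn : ¬ CC G (X ∪ Y) := fun h => ht ((cc_iff _ _).2 h)
    have hG : CC G Finset.univ := by
      obtain ⟨v⟩ := hconn.nonempty
      refine ⟨⟨v, Finset.mem_univ v⟩, ?_⟩
      rintro T - ⟨t, ht⟩ ⟨z, -, hz⟩
      obtain ⟨p⟩ := hconn.preconnected t z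
      obtain ⟨d, -, h1, h2⟩ := p.exists_boundary_dart {v | v ∈ T} ht hz
      exact ⟨d.fst, h1, d.snd, Finset.mem_univ _, h2, d.adj⟩
    exact main _ (nontouch_upper hP4 hG hX' hY' hn hcard) (fun m hm => nontouch_lower hY' hX' hn hm)
end

section
/- Let G be a connected graph and let X, Y ⊆ V(G) be connected vertex subsets with |X| = |Y|. Then there exists a sequence ⟨U_0 = X, U_1, …, U_ℓ = Y⟩ of connected vertex subsets of G such that for all i ∈ {0, 1, …, ℓ − 1}, |U_i \ U_{i+1}| = |U_{i+1} \ U_i| = 1 (in particular every U_i has |U_i| = |X|). -/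
theorem conn_single {V : Type*} (G : SimpleGraph V) (v : V) : IsConnSub G {v} := by
  unfold IsConnSub
  rw [Finset.coe_singleton]
  haveI : Nonempty ({v} : Set V) := ⟨⟨v, rfl⟩⟩
  refine ⟨fun a b => ?_⟩
  rw [Subsingleton.elim a b]

theorem conn_insert {V : Type*} [DecidableEq V] (G : SimpleGraph V) {C : Finset V} {c v : V}
    (hC : IsConnSub G C) (hc : c ∈ C) (h : G.Adj c v) : IsConnSub G (insert v C) := by
  have h1 := conn_single G v
  unfold IsConnSub at *
  have := SimpleGraph.connected_induce_union (v := c) (w := v) hC.preconnected h1.preconnected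
    (by simpa using hc) (by simp) h
  have e : ((insert v C : Finset V) : Set V) = (C : Set V) ∪ (({v} : Finset V) : Set V) := by
    ext; simp [or_comm]
  rw [e]; exact this

theorem conn_cross {V : Type*} [DecidableEq V] (G : SimpleGraph V) {C X : Finset V}
    (hX : IsConnSub G X) (hne : C.Nonempty) (hs : C ⊂ X) :
    ∃ c ∈ C, ∃ v ∈ X, v ∉ C ∧ G.Adj c v := by
  obtain ⟨c, hc⟩ := hne
  obtain ⟨hsub, hn⟩ := Finset.ssubset_iff_subset_ne.1 hs
  obtain ⟨x, hx, hxC⟩ := Finset.exists_of_ssubset hs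
  obtain ⟨p⟩ := hX.preconnected ⟨c, hsub hc⟩ ⟨x, hx⟩
  obtain ⟨d, -, h1, h2⟩ := p.exists_boundary_dart {a | a.1 ∈ C} hc hxC
  exact ⟨d.fst.1, h1, d.snd.1, d.snd.2, h2, d.adj⟩

theorem conn_remove {V : Type*} [DecidableEq V] (G : SimpleGraph V) {X : Finset V}
    (hX : IsConnSub G X) (n : ℕ) : ∀ C : Finset V, X.card - C.card = n → IsConnSub G C →
    C.Nonempty → C ⊂ X → ∃ x ∈ X, x ∉ C ∧ IsConnSub G (X.erase x) := by
  induction n with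
  | zero =>
    intro C h _ _ hs
    have := Finset.card_lt_card hs
    omega
  | succ n ih =>
    intro C h hC hne hs
    obtain ⟨c, hc, v, hv, hvC, hadj⟩ := conn_cross G hX hne hs
    have hsub : insert v C ⊆ X := Finset.insert_subset hv hs.subset
    by_cases he : insert v C = X
    · refine ⟨v, hv, hvC, ?_⟩
      rw [← he, Finset.erase_insert hvC]; exact hC
    · obtain ⟨x, hx, hxC, hh⟩ := ih (insert v C)
        (by rw [Finset.card_insert_of_notMem hvC]; omega)
        (conn_insert G hC hc hadj) (by simp) (Finset.ssubset_iff_subset_ne.2 ⟨hsub, he⟩)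
      exact ⟨x, hx, fun h => hxC (Finset.mem_insert_of_mem h), hh⟩

def Linked {V : Type*} [DecidableEq V] (G : SimpleGraph V) (X Y : Finset V) : Prop :=
  ∃ (ℓ : ℕ) (W : ℕ → Finset V), W 0 = X ∧ W ℓ = Y ∧
      (∀ i ≤ ℓ, IsConnSub G (W i)) ∧
      ∀ i < ℓ, ((W i) \ (W (i + 1))).card = 1 ∧ ((W (i + 1)) \ (W i)).card = 1

theorem linked_refl {V : Type*} [DecidableEq V] (G : SimpleGraph V) {X : Finset V}
    (hX : IsConnSub G X) : Linked G X X :=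
  ⟨0, fun _ => X, rfl, rfl, fun _ _ => hX, fun i hi => absurd hi (by omega)⟩

theorem linked_head {V : Type*} [DecidableEq V] (G : SimpleGraph V) {X Y : Finset V} {x y : V}
    (hX : IsConnSub G X) (hx : x ∈ X) (hy : y ∉ X) (h : Linked G (insert y (X.erase x)) Y) :
    Linked G X Y := by
  obtain ⟨l, W, h0, hl, hc, hs⟩ := h
  have hxy : x ≠ y := fun e => hy (e ▸ hx)
  refine ⟨l + 1, fun i => Nat.casesOn i X W, rfl, hl, ?_, ?_⟩
  · rintro (_ | i) hi
    · exact hX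
    · exact hc i (by omega)
  · rintro (_ | i) hi
    · show (X \ W 0).card = 1 ∧ (W 0 \ X).card = 1
      rw [h0]
      constructor
      · rw [Finset.card_eq_one]
        exact ⟨x, by ext a; simp only [Finset.mem_sdiff, Finset.mem_insert, Finset.mem_erase, Finset.mem_singleton]; grind⟩
      · rw [Finset.card_eq_one]
        exact ⟨y, by ext a; simp only [Finset.mem_sdiff, Finset.mem_insert, Finset.mem_erase, Finset.mem_singleton]; grind⟩
    · exact hs i (by omega)

theorem card_swap {V : Type*} [DecidableEq V] {X : Finset V} {x y : V}
    (hx : x ∈ X) (hy : y ∉ X) : (insert y (X.erase x)).card = X.card := by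
  rw [Finset.card_insert_of_notMem (fun h => hy (Finset.mem_of_mem_erase h)),
    Finset.card_erase_of_mem hx]
  have := Finset.card_pos.2 ⟨x, hx⟩
  omega

theorem linked_inter {V : Type*} [DecidableEq V] (G : SimpleGraph V) {Y : Finset V}
    (hY : IsConnSub G Y) (n : ℕ) : ∀ C X : Finset V, Y.card - C.card = n → IsConnSub G C →
    C.Nonempty → C ⊆ X → C ⊆ Y → IsConnSub G X → X.card = Y.card → Linked G X Y := by
  induction n with
  | zero =>
    intro C X h _ _ hCX hCY hX hcard
    have h1 := Finset.eq_of_subset_of_card_le hCX (by omega)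
    have h2 := Finset.eq_of_subset_of_card_le hCY (by omega)
    rw [← h1, h2]; exact linked_refl G hY
  | succ n ih =>
    intro C X h hC hne hCX hCY hX hcard
    have hCYs : C ⊂ Y := Finset.ssubset_iff_subset_ne.2 ⟨hCY, by rintro rfl; omega⟩
    have hCXs : C ⊂ X := Finset.ssubset_iff_subset_ne.2 ⟨hCX, by rintro rfl; omega⟩
    obtain ⟨c, hc, y, hy, hyC, hadj⟩ := conn_cross G hY hne hCYs
    have hC' := conn_insert G hC hc hadj
    have hn : Y.card - (insert y C).card = n := by
      rw [Finset.card_insert_of_notMem hyC]; omega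
    have hCY' : insert y C ⊆ Y := Finset.insert_subset hy hCY
    by_cases hyX : y ∈ X
    · exact ih _ X hn hC' (by simp) (Finset.insert_subset hyX hCX) hCY' hX hcard
    · obtain ⟨x, hx, hxC, hXx⟩ := conn_remove G hX _ C rfl hC hne hCXs
      have hCe : C ⊆ X.erase x := Finset.subset_erase.2 ⟨hCX, hxC⟩
      refine linked_head G hX hx hyX (ih _ _ hn hC' (by simp) (Finset.insert_subset_insert _ hCe)
        hCY' (conn_insert G hXx (hCe hc) hadj) ?_)
      rw [card_swap hx hyX, hcard]

theorem linked_walk {V : Type*} [DecidableEq V] (G : SimpleGraph V) {Y : Finset V}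
    (hY : IsConnSub G Y) {a b : V} (p : G.Walk a b) : b ∈ Y → ∀ X : Finset V, a ∈ X →
    IsConnSub G X → X.card = Y.card → Linked G X Y := by
  induction p with
  | nil =>
    intro hb X ha hX hcard
    exact linked_inter G hY _ {_} X rfl (conn_single G _) (by simp) (by simpa using ha)
      (by simpa using hb) hX hcard
  | @cons u v w hadj p ih =>
    intro hb X ha hX hcard
    by_cases hv : v ∈ X
    · exact ih hb X hv hX hcard
    by_cases he : {u} = X
    · subst he
      refine linked_head G hX ha hv (ih hb _ (by simp) ?_ ?_)
      · simpa using conn_single G v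
      · rw [card_swap ha hv, hcard]
    · obtain ⟨x, hx, hxu, hXx⟩ := conn_remove G hX _ {u} rfl (conn_single G u) (by simp)
        (Finset.ssubset_iff_subset_ne.2 ⟨by simpa using ha, he⟩)
      have hux : u ∈ X.erase x := Finset.mem_erase.2 ⟨fun e => hxu (by simp [e]), ha⟩
      refine linked_head G hX hx hv (ih hb _ (by simp) (conn_insert G hXx hux hadj) ?_)
      rw [card_swap hx hv, hcard]

/-- In a connected graph, any two connected vertex subsets of the same
size are linked by a sequence of connected vertex subsets in which consecutive subsets
exchange exactly one vertex. -/
theorem stmt16 {V : Type*} [DecidableEq V] (G : SimpleGraph V) (hconn : G.Connected)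
    (X Y : Finset V) (hX : IsConnSub G X) (hY : IsConnSub G Y)
    (hcard : X.card = Y.card) :
    ∃ (ℓ : ℕ) (W : ℕ → Finset V), W 0 = X ∧ W ℓ = Y ∧
      (∀ i ≤ ℓ, IsConnSub G (W i)) ∧
      ∀ i < ℓ, ((W i) \ (W (i + 1))).card = 1 ∧ ((W (i + 1)) \ (W i)).card = 1 := by
  obtain ⟨⟨a, ha⟩⟩ := hX.nonempty
  obtain ⟨⟨b, hb⟩⟩ := hY.nonempty
  obtain ⟨p⟩ := hconn.preconnected a b
  exact linked_walk G hY p hb X ha hX hcard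
end
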